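/- arXiv:math/0203059 — 2 statements merged into one kernel-verified Lean document; each statement's English description precedes it below -/
import Mathlib

section
/- Let n ≥ 7 be an integer and θ ∈ (0, π). Set δ = cos θ, and let r = max{ s ∈ ℕ : x_s ≤ δ − 2n^{−1/2} }, where x_s is the maximal root of P_s (assume this set is nonempty). Then there is an absolute constant c > 0 (independent of n and θ) such that M_LP(n,θ) ≥ c · (1/(r·n^{1/2})) · (1/(1−δ²))^{(n−4)/4} · P_r(1)/‖P_r‖₂. -/
open Polynomial Set

/-- `IsJacobi α s P` says that `P` is the Jacobi polynomial `P_s^{(α,α)}`: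
the unique real polynomial of degree `s` orthogonal to all lower-degree
monomials with respect to the weight `(1 - t²)^α` on `(-1,1)`, normalized by
`P(1) = Γ(s+α+1)/(Γ(α+1)·s!)`. -/
def IsJacobi (α : ℝ) (s : ℕ) (P : Polynomial ℝ) : Prop :=
  P.degree = (s : ℕ) ∧
  (∀ j < s, (∫ t in (-1 : ℝ)..1, P.eval t * t ^ j * (1 - t ^ 2) ^ α) = 0) ∧
  P.eval 1 = Real.Gamma ((s : ℝ) + α + 1) / (Real.Gamma (α + 1) * (Nat.factorial s : ℝ))

/-- The weight function `w(t) = (1-t²)^{(n-3)/2}`. -/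
noncomputable def jWeight (n : ℕ) (t : ℝ) : ℝ := (1 - t ^ 2) ^ (((n : ℝ) - 3) / 2)

/-- `‖P‖₂ = (∫_{-1}^1 P(t)² (1-t²)^{(n-3)/2} dt)^{1/2}`. -/
noncomputable def jNorm (n : ℕ) (P : Polynomial ℝ) : ℝ :=
  Real.sqrt (∫ t in (-1 : ℝ)..1, (P.eval t) ^ 2 * jWeight n t)

/-- `M_LP(n,θ)`: infimum of `F(1)` over polynomials `F = Σ a_s P_s` with
`a_s ≥ 0`, `a_0 = 1`, and `F ≤ 0` on `[-1, cos θ]`. -/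
noncomputable def MLP (θ : ℝ) (P : ℕ → Polynomial ℝ) : ℝ :=
  sInf { y : ℝ | ∃ (m : ℕ) (a : ℕ → ℝ) (F : Polynomial ℝ),
    F = ∑ s ∈ Finset.range (m + 1), Polynomial.C (a s) * P s ∧
    (∀ s, 0 ≤ a s) ∧ a 0 = 1 ∧
    (∀ t ∈ Set.Icc (-1 : ℝ) (Real.cos θ), F.eval t ≤ 0) ∧ y = F.eval 1 }

/-- Integration of polynomials over `[-1, 1]` against the Gegenbauer weight `(1 - t²)^α`. -/
noncomputable def gegenbauerIntegral (α : ℝ) (hα : 0 ≤ α) : ℝ[X] →ₗ[ℝ] ℝ where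
  toFun Q := ∫ t in (-1 : ℝ)..1, Q.eval t * (1 - t ^ 2) ^ α
  map_add' Q R := by
    have hw : Continuous fun t : ℝ => (1 - t ^ 2) ^ α :=
      (by fun_prop : Continuous fun t : ℝ => 1 - t ^ 2).rpow_const fun _ => Or.inr hα
    simp only [eval_add, add_mul]
    exact intervalIntegral.integral_add ((Q.continuous.mul hw).intervalIntegrable _ _)
      ((R.continuous.mul hw).intervalIntegrable _ _)
  map_smul' c Q := by
    simp only [eval_smul, smul_eq_mul, mul_assoc, RingHom.id_apply,
      intervalIntegral.integral_const_mul]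

section Functional

variable {α : ℝ} (hα : 0 ≤ α)

lemma continuous_weight (hα : 0 ≤ α) : Continuous fun t : ℝ => (1 - t ^ 2) ^ α :=
  (by fun_prop : Continuous fun t : ℝ => 1 - t ^ 2).rpow_const fun _ => Or.inr hα

lemma weight_nonneg {t : ℝ} (α : ℝ) (ht : t ∈ Icc (-1 : ℝ) 1) : 0 ≤ (1 - t ^ 2) ^ α :=
  Real.rpow_nonneg (by nlinarith [ht.1, ht.2]) _

lemma weight_pos {t : ℝ} (α : ℝ) (ht : t ∈ Ioo (-1 : ℝ) 1) : 0 < (1 - t ^ 2) ^ α :=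
  Real.rpow_pos_of_pos (by nlinarith [ht.1, ht.2]) _

lemma intervalIntegrable_mul_weight (hα : 0 ≤ α) (Q : ℝ[X]) (a b : ℝ) :
    IntervalIntegrable (fun t => Q.eval t * (1 - t ^ 2) ^ α) MeasureTheory.volume a b :=
  (Q.continuous.mul (continuous_weight hα)).intervalIntegrable _ _

lemma gegenbauerIntegral_apply (Q : ℝ[X]) :
    gegenbauerIntegral α hα Q = ∫ t in (-1 : ℝ)..1, Q.eval t * (1 - t ^ 2) ^ α := rfl

lemma gegenbauerIntegral_nonneg {Q : ℝ[X]} (hQ : ∀ t ∈ Icc (-1 : ℝ) 1, 0 ≤ Q.eval t) :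
    0 ≤ gegenbauerIntegral α hα Q :=
  intervalIntegral.integral_nonneg (by norm_num) fun t ht =>
    mul_nonneg (hQ t ht) (weight_nonneg α ht)

lemma gegenbauerIntegral_pos {Q : ℝ[X]} (hQ : ∀ t ∈ Icc (-1 : ℝ) 1, 0 ≤ Q.eval t)
    (h0 : Q ≠ 0) : 0 < gegenbauerIntegral α hα Q := by
  obtain ⟨t, ht, htQ⟩ : ∃ t ∈ Ioo (-1 : ℝ) 1, Q.eval t ≠ 0 := by
    by_contra! h
    exact h0 (Q.eq_zero_of_infinite_isRoot ((Ioo_infinite (by norm_num)).mono h))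
  refine intervalIntegral.integral_pos (by norm_num)
    (Q.continuous.mul (continuous_weight hα)).continuousOn
    (fun u hu => mul_nonneg (hQ u (Ioc_subset_Icc_self hu))
      (weight_nonneg α (Ioc_subset_Icc_self hu)))
    ⟨t, Ioo_subset_Icc_self ht, ?_⟩
  exact mul_pos ((hQ t (Ioo_subset_Icc_self ht)).lt_of_ne' htQ) (weight_pos α ht)

lemma gegenbauerIntegral_comp_neg (Q : ℝ[X]) :
    gegenbauerIntegral α hα (Q.comp (-X)) = gegenbauerIntegral α hα Q := by
  have := intervalIntegral.integral_comp_neg (a := -1) (b := 1)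
    fun t : ℝ => Q.eval t * (1 - t ^ 2) ^ α
  simpa [gegenbauerIntegral_apply] using this

/-- The first-order operator `D` for which `(1 - t²)^α · (D G)` is the derivative of
`(1 - t²)^(α + 1) · G`. -/
noncomputable def weightedDeriv (α : ℝ) (G : ℝ[X]) : ℝ[X] :=
  (1 - X ^ 2) * derivative G - C (2 * α + 2) * X * G

lemma integral_weightedDeriv (hα : 0 ≤ α) (G : ℝ[X]) {a b : ℝ} (ha : -1 ≤ a) (hab : a ≤ b)
    (hb : b ≤ 1) :
    ∫ t in a..b, (weightedDeriv α G).eval t * (1 - t ^ 2) ^ α =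
      (1 - b ^ 2) ^ (α + 1) * G.eval b - (1 - a ^ 2) ^ (α + 1) * G.eval a := by
  refine intervalIntegral.integral_eq_sub_of_hasDerivAt
    (f := fun t => (1 - t ^ 2) ^ (α + 1) * G.eval t) (fun t ht => ?_)
    (intervalIntegrable_mul_weight hα _ _ _)
  rw [uIcc_of_le hab] at ht
  have h1 : HasDerivAt (fun t : ℝ => 1 - t ^ 2) (-(2 * t)) t := by
    simpa using (hasDerivAt_pow 2 t).const_sub 1
  have h2 := (h1.rpow_const (p := α + 1) (Or.inr (by linarith))).mul (G.hasDerivAt t)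
  have h3 : (1 - t ^ 2) ^ (α + 1) = (1 - t ^ 2) ^ α * (1 - t ^ 2) :=
    Real.rpow_add_one' (by nlinarith [ht.1, ht.2]) (by linarith)
  convert! h2 using 1
  simp only [weightedDeriv, eval_sub, eval_mul, eval_pow, eval_X, eval_C, eval_one, h3,
    add_sub_cancel_right]
  ring

lemma gegenbauerIntegral_weightedDeriv (G : ℝ[X]) :
    gegenbauerIntegral α hα (weightedDeriv α G) = 0 := by
  rw [gegenbauerIntegral_apply, integral_weightedDeriv hα G le_rfl (by norm_num) le_rfl]
  norm_num [Real.zero_rpow (by linarith : α + 1 ≠ 0)]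

lemma gegenbauerIntegral_mul_weightedDeriv (P Q : ℝ[X]) :
    gegenbauerIntegral α hα (P * weightedDeriv α Q) =
      -gegenbauerIntegral α hα ((1 - X ^ 2) * derivative P * Q) := by
  rw [← add_eq_zero_iff_eq_neg, ← map_add, ← gegenbauerIntegral_weightedDeriv hα (P * Q)]
  congr 1
  simp only [weightedDeriv, derivative_mul]
  ring

lemma gegenbauerIntegral_mul_weightedDeriv_derivative (P Q : ℝ[X]) :
    gegenbauerIntegral α hα (P * weightedDeriv α (derivative Q)) =
      gegenbauerIntegral α hα (Q * weightedDeriv α (derivative P)) := by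
  simp only [gegenbauerIntegral_mul_weightedDeriv]
  congr 2
  ring

lemma coeff_X_mul_derivative (G : ℝ[X]) (j : ℕ) :
    (X * derivative G).coeff j = j * G.coeff j := by
  cases j with
  | zero => simp
  | succ j => rw [coeff_X_mul, coeff_derivative]; push_cast; ring

lemma coeff_weightedDeriv_succ (G : ℝ[X]) (j : ℕ) :
    (weightedDeriv α G).coeff (j + 1) =
      (j + 2) * G.coeff (j + 2) - (j + (2 * α + 2)) * G.coeff j := by
  have : weightedDeriv α G = derivative G - X * (X * derivative G) - C (2 * α + 2) * (X * G) := by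
    simp only [weightedDeriv]; ring
  rw [this, coeff_sub, coeff_sub, coeff_X_mul, coeff_C_mul, coeff_X_mul, coeff_X_mul_derivative,
    coeff_derivative]
  push_cast
  ring

lemma degree_weightedDeriv_lt {G : ℝ[X]} {s : ℕ} (hG : G.degree < s) :
    (weightedDeriv α G).degree < (s + 1 : ℕ) := by
  rw [degree_lt_iff_coeff_zero] at hG ⊢
  rintro (_ | j) hj
  · omega
  · rw [coeff_weightedDeriv_succ, hG _ (by omega), hG _ (by omega)]
    ring

lemma coeff_weightedDeriv_derivative (P : ℝ[X]) (j : ℕ) :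
    (weightedDeriv α (derivative P)).coeff j =
      (j + 2) * (j + 1) * P.coeff (j + 2) - j * (j + 2 * α + 1) * P.coeff j := by
  cases j with
  | zero =>
    rw [coeff_zero_eq_eval_zero]
    simp only [weightedDeriv, eval_sub, eval_mul, eval_one, eval_X, eval_pow]
    rw [← coeff_zero_eq_eval_zero, coeff_derivative, coeff_derivative]
    norm_num
    ring
  | succ j =>
    rw [coeff_weightedDeriv_succ, coeff_derivative, coeff_derivative]
    push_cast
    ring

lemma degree_weightedDeriv_derivative_lt {P : ℝ[X]} {s : ℕ} (hP : P.degree < s) :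
    (weightedDeriv α (derivative P)).degree < s := by
  rw [degree_lt_iff_coeff_zero] at hP ⊢
  intro j hj
  rw [coeff_weightedDeriv_derivative, hP _ (by omega), hP _ hj]
  ring

/-- `P` is orthogonal to every polynomial of degree less than `s`. -/
def OrthBelow (s : ℕ) (P : ℝ[X]) : Prop :=
  ∀ Q : ℝ[X], Q.degree < s → gegenbauerIntegral α hα (P * Q) = 0

variable {hα} {s : ℕ} {P : ℝ[X]}

lemma OrthBelow.eq_zero (h : OrthBelow hα s P) (hdeg : P.degree < s) : P = 0 := by
  by_contra h0
  refine (gegenbauerIntegral_pos hα (Q := P * P) (fun t _ => ?_) (mul_ne_zero h0 h0)).ne' (h P hdeg)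
  rw [eval_mul]
  exact mul_self_nonneg _

lemma IsJacobi.orthBelow (h : IsJacobi α s P) : OrthBelow hα s P := by
  intro Q hQ
  rw [Q.as_sum_range_C_mul_X_pow, Finset.mul_sum, map_sum]
  refine Finset.sum_eq_zero fun i _ => ?_
  rw [mul_left_comm, ← smul_eq_C_mul, map_smul]
  by_cases hi : i < s
  · have := h.2.1 i hi
    rw [gegenbauerIntegral_apply]
    simp only [eval_mul, eval_pow, eval_X, this, smul_zero]
  · rw [degree_lt_iff_coeff_zero] at hQ
    rw [hQ i (by omega), zero_smul]

lemma OrthBelow.comp_neg_X (h : OrthBelow hα s P) (hdeg : P.degree = s) :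
    P.comp (-X) = C ((-1) ^ s) * P := by
  rw [← sub_eq_zero]
  refine OrthBelow.eq_zero (hα := hα) (s := s) (fun Q hQ => ?_) ?_
  · rw [sub_mul, map_sub, mul_assoc, ← smul_eq_C_mul, map_smul, h Q hQ, smul_zero, sub_zero,
      ← gegenbauerIntegral_comp_neg, mul_comp, comp_assoc]
    simp only [neg_comp, X_comp, neg_neg, comp_X]
    exact h _ (by rwa [degree_comp_neg_X])
  · rw [degree_lt_iff_coeff_zero]
    intro j hj
    rw [coeff_sub, show (-X : ℝ[X]) = C (-1) * X by simp, comp_C_mul_X_coeff, coeff_C_mul]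
    rcases hj.eq_or_lt with rfl | hj
    · rw [mul_comm, sub_self]
    · rw [coeff_eq_zero_of_degree_lt (hdeg ▸ by exact_mod_cast hj)]
      simp

lemma OrthBelow.weightedDeriv_derivative (h : OrthBelow hα s P) (hdeg : P.degree = s) :
    weightedDeriv α (derivative P) = -(C (s * (s + 2 * α + 1)) * P) := by
  rw [← add_eq_zero_iff_eq_neg]
  refine OrthBelow.eq_zero (hα := hα) (s := s) (fun Q hQ => ?_) ?_
  · rw [add_mul, map_add, mul_assoc, ← smul_eq_C_mul, map_smul, h Q hQ, smul_zero, add_zero,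
      mul_comm, gegenbauerIntegral_mul_weightedDeriv_derivative]
    exact h _ (degree_weightedDeriv_derivative_lt hQ)
  · rw [degree_lt_iff_coeff_zero]
    intro j hj
    have hlt (i : ℕ) (hi : s < i) : P.coeff i = 0 :=
      coeff_eq_zero_of_degree_lt (hdeg ▸ by exact_mod_cast hi)
    rw [coeff_add, coeff_weightedDeriv_derivative, coeff_C_mul, hlt (j + 2) (by omega)]
    rcases hj.eq_or_lt with rfl | hj
    · ring
    · rw [hlt j hj]
      ring

lemma OrthBelow.eq_zero_of_eq_mul (h : OrthBelow hα s P) (hdeg : P.degree = s) {q R : ℝ[X]}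
    (hqR : P = q * R) (hq : 0 < q.degree) (hq0 : ∀ t ∈ Icc (-1 : ℝ) 1, 0 ≤ q.eval t) :
    False := by
  have hP0 : P ≠ 0 := by rintro rfl; simp at hdeg
  have hR0 : R ≠ 0 := by rintro rfl; simp [hqR] at hP0
  have hR : R.degree < s := by
    rw [← hdeg, hqR, degree_mul, degree_eq_natDegree hR0]
    rw [degree_eq_natDegree (by rintro rfl; simp at hq)] at hq ⊢
    norm_cast at hq ⊢
    omega
  refine (gegenbauerIntegral_pos hα (Q := P * R) (fun t ht => ?_) (mul_ne_zero hP0 hR0)).ne'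
    (h R hR)
  rw [hqR, eval_mul, eval_mul, mul_assoc]
  exact mul_nonneg (hq0 t ht) (mul_self_nonneg _)

lemma OrthBelow.root_lt_one (h : OrthBelow hα s P) (hdeg : P.degree = s) {a : ℝ}
    (ha : P.eval a = 0) : a < 1 := by
  by_contra! h1
  obtain ⟨R, hR⟩ := dvd_iff_isRoot.2 ha
  refine h.eq_zero_of_eq_mul hdeg (q := -(X - C a)) (R := -R) (by rw [hR]; ring) ?_
    fun t ht => ?_
  · rw [degree_neg, degree_X_sub_C]
    exact one_pos
  · simp only [eval_neg, eval_sub, eval_X, eval_C]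
    linarith [ht.2]

lemma OrthBelow.splits (h : OrthBelow hα s P) (hdeg : P.degree = s) : P.Splits := by
  refine Splits.of_splits_map (algebraMap ℝ ℂ) (IsAlgClosed.splits _) fun z hz => ?_
  by_cases him : z.im = 0
  · exact ⟨z.re, Complex.ext (by simp) (by simp [him])⟩
  · exfalso
    have hz0 : aeval z P = 0 := by
      rw [← eval_map_algebraMap]
      exact (mem_roots'.1 hz).2
    obtain ⟨R, hR⟩ := P.quadratic_dvd_of_aeval_eq_zero_im_ne_zero hz0 him
    refine h.eq_zero_of_eq_mul hdeg hR ?_ fun t _ => ?_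
    · have : (X ^ 2 - C (2 * z.re) * X + C (‖z‖ ^ 2) : ℝ[X]).degree = 2 := by compute_degree!
      rw [this]
      norm_num
    · simp only [eval_add, eval_sub, eval_mul, eval_pow, eval_X, eval_C]
      have : ‖z‖ ^ 2 = z.re ^ 2 + z.im ^ 2 := by
        rw [Complex.sq_norm, Complex.normSq_apply]; ring
      nlinarith [sq_nonneg (t - z.re), sq_nonneg z.im]

lemma OrthBelow.exists_ladder {Q : ℝ[X]} (h : OrthBelow hα (s + 1) P)
    (hdeg : P.degree = (s + 1 : ℕ)) (hQ : OrthBelow hα s Q) (hQdeg : Q.degree = s) :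
    ∃ κ : ℝ, (1 - X ^ 2) * derivative P + C (s + 1 : ℝ) * X * P = C κ * Q := by
  set E := (1 - X ^ 2) * derivative P + C (s + 1 : ℝ) * X * P with hE
  have hQs : Q.coeff s ≠ 0 := coeff_ne_zero_of_eq_degree hQdeg
  have hPlt (i : ℕ) (hi : s + 1 < i) : P.coeff i = 0 :=
    coeff_eq_zero_of_degree_lt (hdeg ▸ by exact_mod_cast hi)
  have hQlt (i : ℕ) (hi : s < i) : Q.coeff i = 0 :=
    coeff_eq_zero_of_degree_lt (hQdeg ▸ by exact_mod_cast hi)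
  have hPs : P.coeff s = 0 := by
    have := congrArg (fun p => coeff p s) (h.comp_neg_X hdeg)
    simp only [show (-X : ℝ[X]) = C (-1) * X by simp, comp_C_mul_X_coeff, coeff_C_mul,
      pow_succ] at this
    have h1 : (-1 : ℝ) ^ s ≠ 0 := by positivity
    have h2 : (-1 : ℝ) ^ s * P.coeff s = 0 := by linarith
    exact (mul_eq_zero.1 h2).resolve_left h1
  have hEcoeff (j : ℕ) :
      E.coeff (j + 1) = (j + 2) * P.coeff (j + 2) - (j - (s + 1)) * P.coeff j := by
    have : E = weightedDeriv (-(s + 3) / 2 : ℝ) P := by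
      rw [weightedDeriv, hE, show 2 * (-(s + 3) / 2 : ℝ) + 2 = -(s + 1) by ring, C_neg]
      ring
    rw [this, coeff_weightedDeriv_succ]
    ring
  refine ⟨E.coeff s / Q.coeff s, ?_⟩
  rw [← sub_eq_zero]
  refine OrthBelow.eq_zero (hα := hα) (s := s) (fun R hR => ?_) ?_
  · have h1 : (E - C (E.coeff s / Q.coeff s) * Q) * R = (1 - X ^ 2) * derivative P * R +
        (s + 1 : ℝ) • (P * (X * R)) - (E.coeff s / Q.coeff s) • (Q * R) := by
      rw [hE, smul_eq_C_mul, smul_eq_C_mul]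
      ring
    have h2 : gegenbauerIntegral α hα ((1 - X ^ 2) * derivative P * R) = 0 := by
      rw [← neg_eq_zero, ← gegenbauerIntegral_mul_weightedDeriv]
      exact h _ (degree_weightedDeriv_lt hR)
    have h3 : gegenbauerIntegral α hα (P * (X * R)) = 0 := by
      refine h _ ?_
      rw [degree_lt_iff_coeff_zero] at hR ⊢
      rintro (_ | j) hj
      · omega
      · rw [coeff_X_mul, hR _ (by omega)]
    rw [h1, map_sub, map_add, map_smul, map_smul, h2, h3, hQ R hR]
    simp
  · rw [degree_lt_iff_coeff_zero]
    intro j hj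
    rw [coeff_sub, coeff_C_mul]
    rcases hj.eq_or_lt with rfl | hj
    · field_simp
      ring
    · obtain ⟨i, rfl⟩ : ∃ i, j = i + 1 := ⟨j - 1, by omega⟩
      rw [hEcoeff, hQlt _ hj, hPlt (i + 2) (by omega)]
      rcases (by omega : i = s ∨ i = s + 1 ∨ s + 1 < i) with rfl | rfl | hi
      · rw [hPs]; ring
      · push_cast; ring
      · rw [hPlt i hi]; ring

lemma gegenbauerIntegral_ladder_ge (h1α : 1 ≤ α) {Q : ℝ[X]} {κ : ℝ}
    (h : OrthBelow hα (s + 1) P) (hdeg : P.degree = (s + 1 : ℕ))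
    (hκ : (1 - X ^ 2) * derivative P + C (s + 1 : ℝ) * X * P = C κ * Q) :
    (s + 1) ^ 2 * gegenbauerIntegral α hα (P ^ 2) ≤ κ ^ 2 * gegenbauerIntegral α hα (Q ^ 2) := by
  have hode := h.weightedDeriv_derivative hdeg
  have key : κ ^ 2 • Q ^ 2 = ((s : ℝ) + 1) ^ 2 • P ^ 2 +
      weightedDeriv α ((1 - X ^ 2) * P * derivative P) +
      ((s : ℝ) + 2) • weightedDeriv α (X * P ^ 2) +
      (C (2 * α * (s + 1) - 1) + C (2 * (s + 1) + 2 * α + 3) * X ^ 2) * P ^ 2 := by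
    have : κ ^ 2 • Q ^ 2 = (C κ * Q) ^ 2 := by rw [smul_eq_C_mul, C_pow, mul_pow]
    rw [this, ← hκ]
    simp only [weightedDeriv, smul_eq_C_mul, derivative_mul, derivative_pow,
      derivative_X, derivative_one, map_add, map_sub, map_mul, map_pow, map_natCast, map_ofNat,
      map_one, Nat.cast_add, Nat.cast_one, Nat.cast_ofNat] at hode ⊢
    linear_combination (-(1 - X ^ 2) * P) * hode
  have := congrArg (gegenbauerIntegral α hα) key
  rw [map_add, map_add, map_add, map_smul, map_smul, map_smul,
    gegenbauerIntegral_weightedDeriv, gegenbauerIntegral_weightedDeriv] at this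
  have hnn : 0 ≤ gegenbauerIntegral α hα
      ((C (2 * α * (s + 1) - 1) + C (2 * (s + 1) + 2 * α + 3) * X ^ 2) * P ^ 2) := by
    refine gegenbauerIntegral_nonneg hα fun t _ => ?_
    simp only [eval_mul, eval_add, eval_pow, eval_X, eval_C]
    have h1 : 0 ≤ 2 * α * (s + 1) - 1 := by nlinarith [(Nat.cast_nonneg s : (0 : ℝ) ≤ s)]
    positivity
  simp only [smul_eq_mul] at this
  linarith

lemma derivative_bounds_of_splits (hs : P.Splits) {b t : ℝ} (hb : ∀ z, P.eval z = 0 → z ≤ b)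
    (hbt : b < t) (ht : 0 < P.eval t) :
    0 ≤ P.derivative.eval t ∧ P.derivative.eval t * (t - b) ≤ P.natDegree * P.eval t := by
  have hsum := hs.eval_derivative_div_eval_of_ne_zero ht.ne'
  rw [div_eq_iff ht.ne'] at hsum
  have hz (z : ℝ) (hz : z ∈ P.roots) : z ≤ b := hb z (mem_roots'.1 hz).2
  have h0 : 0 ≤ (P.roots.map fun z => 1 / (t - z)).sum := by
    refine Multiset.sum_nonneg fun y hy => ?_
    obtain ⟨z, hz', rfl⟩ := Multiset.mem_map.1 hy
    exact one_div_nonneg.2 (by linarith [hz z hz'])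
  have h1 : (P.roots.map fun z => 1 / (t - z)).sum ≤ P.natDegree * (1 / (t - b)) := by
    refine (Multiset.sum_le_card_nsmul _ (1 / (t - b)) fun y hy => ?_).trans ?_
    · obtain ⟨z, hz', rfl⟩ := Multiset.mem_map.1 hy
      exact one_div_le_one_div_of_le (by linarith) (by linarith [hz z hz'])
    · rw [Multiset.card_map, nsmul_eq_mul]
      have : (P.roots.card : ℝ) ≤ P.natDegree := by exact_mod_cast P.card_roots'
      exact mul_le_mul_of_nonneg_right this (one_div_nonneg.2 (by linarith))
  refine ⟨by rw [hsum]; positivity, ?_⟩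
  have h2 : 0 < t - b := by linarith
  calc P.derivative.eval t * (t - b)
      = (P.roots.map fun z => 1 / (t - z)).sum * (P.eval t * (t - b)) := by rw [hsum]; ring
    _ ≤ P.natDegree * (1 / (t - b)) * (P.eval t * (t - b)) := by gcongr
    _ = P.natDegree * P.eval t := by field_simp

lemma eval_pos_of_forall_root_le {b t : ℝ} (hb : ∀ z, P.eval z = 0 → z ≤ b) (h1 : 0 < P.eval 1)
    (ht : b < t) (ht1 : t ≤ 1) : 0 < P.eval t := by
  by_contra! h
  obtain ⟨z, hz, hz0⟩ := intermediate_value_Icc ht1 P.continuous.continuousOn ⟨h, h1.le⟩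
  linarith [hb z hz0, hz.1]

lemma OrthBelow.nonneg_of_isGreatest_root (h : OrthBelow hα s P) (hdeg : P.degree = s) {x : ℝ}
    (hx : IsGreatest {t : ℝ | P.eval t = 0} x) : 0 ≤ x := by
  have h1 := congrArg (eval x) (h.comp_neg_X hdeg)
  have hx0 : P.eval x = 0 := hx.1
  rw [eval_comp, eval_mul, hx0] at h1
  have : -x ≤ x := hx.2 (by simpa using h1)
  linarith

lemma OrthBelow.root_le_root_succ {Q : ℝ[X]} (h : OrthBelow hα (s + 1) P)
    (hdeg : P.degree = (s + 1 : ℕ)) (hQ : OrthBelow hα s Q) (hQdeg : Q.degree = s)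
    (hP1 : 0 < P.eval 1) {x y : ℝ}
    (hx : IsGreatest {t : ℝ | P.eval t = 0} x) (hy : Q.eval y = 0) : y ≤ x := by
  by_contra! hxy
  have hy1 := hQ.root_lt_one hQdeg hy
  have hx0 := h.nonneg_of_isGreatest_root hdeg hx
  obtain ⟨κ, hκ⟩ := h.exists_ladder hdeg hQ hQdeg
  have e := congrArg (eval y) hκ
  simp only [eval_add, eval_mul, eval_sub, eval_one, eval_pow, eval_X, eval_C, hy] at e
  have hPy := eval_pos_of_forall_root_le hx.2 hP1 hxy hy1.le
  have h2 := (derivative_bounds_of_splits (h.splits hdeg) hx.2 hxy hPy).1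
  have h3 : 0 < 1 - y ^ 2 := by nlinarith
  have h4 : 0 < ((s : ℝ) + 1) * y * P.eval y := by
    have : 0 < y := by linarith
    positivity
  nlinarith [mul_nonneg h3.le h2]

lemma OrthBelow.leadingCoeff_pos (h : OrthBelow hα s P) (hdeg : P.degree = s)
    (h1 : 0 < P.eval 1) : 0 < P.leadingCoeff := by
  have hprod := (h.splits hdeg).eval_eq_prod_roots 1
  have h0 : 0 ≤ (P.roots.map fun z => 1 - z).prod := by
    refine Multiset.prod_nonneg fun y hy => ?_
    obtain ⟨z, hz, rfl⟩ := Multiset.mem_map.1 hy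
    linarith [h.root_lt_one hdeg (mem_roots'.1 hz).2]
  by_contra! hneg
  nlinarith [mul_nonpos_of_nonpos_of_nonneg hneg h0]

lemma OrthBelow.integral_pow_one_add_X_pos (h : OrthBelow hα s P) (hdeg : P.degree = s)
    (h1 : 0 < P.eval 1) : 0 < gegenbauerIntegral α hα (P * (1 + X) ^ s) := by
  have hlc := h.leadingCoeff_pos hdeg h1
  have hP0 : P ≠ 0 := by rintro rfl; simp at hlc
  have hmon : ((1 + X : ℝ[X]) ^ s).Monic := by
    rw [add_comm]
    exact (monic_X_add_C (1 : ℝ)).pow s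
  have hdeg1 : ((1 + X : ℝ[X]) ^ s).degree = s := by
    rw [add_comm, ← C_1, degree_pow, degree_X_add_C]; simp
  have hlow : ((1 + X) ^ s - C P.leadingCoeff⁻¹ * P).degree < (s : WithBot ℕ) := by
    rw [← hdeg1]
    refine degree_sub_lt_left ?_ hmon.ne_zero ?_
    · rw [hdeg1, degree_C_mul (inv_ne_zero hlc.ne'), hdeg]
    · rw [hmon.leadingCoeff, leadingCoeff_mul, leadingCoeff_C, inv_mul_cancel₀ hlc.ne']
  have hz := h _ hlow
  rw [mul_sub, map_sub, mul_left_comm, ← smul_eq_C_mul, map_smul, sub_eq_zero] at hz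
  rw [hz, smul_eq_mul]
  refine mul_pos (inv_pos.2 hlc) (gegenbauerIntegral_pos hα (fun t _ => ?_) (mul_ne_zero hP0 hP0))
  rw [eval_mul]
  exact mul_self_nonneg _

lemma weightedDeriv_derivative_one_add_X_pow (k : ℕ) :
    weightedDeriv α (derivative ((1 + X) ^ (k + 1))) =
      C (2 * (k + 1) * (k + 1 + α)) * (1 + X) ^ k -
        C ((k + 1) * (k + 2 * α + 2)) * (1 + X) ^ (k + 1) := by
  have h1 : (1 + X) * derivative ((1 + X : ℝ[X]) ^ k) = (k : ℝ[X]) * (1 + X) ^ k := by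
    cases k with
    | zero => simp
    | succ k => simp [derivative_pow]; ring
  have h2 : derivative ((1 + X : ℝ[X]) ^ (k + 1)) = ((k : ℝ[X]) + 1) * (1 + X) ^ k := by
    simp [derivative_pow]
  have h3 : derivative (((k : ℝ[X]) + 1) * (1 + X) ^ k) =
      ((k : ℝ[X]) + 1) * derivative ((1 + X) ^ k) := by
    simp [derivative_mul]
  rw [h2, weightedDeriv, h3]
  simp only [map_add, map_mul, map_natCast, map_ofNat, map_one]
  linear_combination ((k : ℝ[X]) + 1) * (1 - X) * h1

lemma OrthBelow.integral_pow_one_add_X_succ (h : OrthBelow hα s P) (hdeg : P.degree = s) (k : ℕ) :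
    ((k + 1) * (k + 2 * α + 2) - s * (s + 2 * α + 1)) *
        gegenbauerIntegral α hα (P * (1 + X) ^ (k + 1)) =
      2 * (k + 1) * (k + 1 + α) * gegenbauerIntegral α hα (P * (1 + X) ^ k) := by
  have e := gegenbauerIntegral_mul_weightedDeriv_derivative hα P ((1 + X) ^ (k + 1))
  rw [weightedDeriv_derivative_one_add_X_pow, h.weightedDeriv_derivative hdeg, mul_sub, map_sub,
    mul_left_comm, mul_left_comm P, mul_neg, map_neg, mul_left_comm ((1 + X) ^ (k + 1)),
    ← smul_eq_C_mul, ← smul_eq_C_mul, ← smul_eq_C_mul, map_smul, map_smul, map_smul,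
    mul_comm _ P] at e
  simp only [smul_eq_mul] at e
  linear_combination -e

lemma OrthBelow.integral_pow_one_add_X_pos_of_le (h : OrthBelow hα s P) (hdeg : P.degree = s)
    (h1 : 0 < P.eval 1) {k : ℕ} (hk : s ≤ k) :
    0 < gegenbauerIntegral α hα (P * (1 + X) ^ k) := by
  induction k, hk using Nat.le_induction with
  | base => exact h.integral_pow_one_add_X_pos hdeg h1
  | succ k hk ih =>
    have e := h.integral_pow_one_add_X_succ hdeg k
    have hk' : (s : ℝ) ≤ k := by exact_mod_cast hk
    have hs : (0 : ℝ) ≤ s := Nat.cast_nonneg s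
    have hA : 0 < ((k : ℝ) + 1) * (k + 2 * α + 2) - s * (s + 2 * α + 1) := by nlinarith
    have hB : 0 < 2 * ((k : ℝ) + 1) * (k + 1 + α) * gegenbauerIntegral α hα (P * (1 + X) ^ k) := by
      positivity
    rw [← e] at hB
    exact (mul_pos_iff_of_pos_left hA).1 hB

lemma OrthBelow.integral_pow_one_add_X_eq_zero (h : OrthBelow hα s P) {k : ℕ} (hk : k < s) :
    gegenbauerIntegral α hα (P * (1 + X) ^ k) = 0 := by
  refine h _ ?_
  rw [add_comm, ← C_1, degree_pow, degree_X_add_C]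
  simpa using hk

end Functional

section Sequence

variable {α : ℝ} {P : ℕ → ℝ[X]}

lemma IsJacobi.eval_one_pos {s : ℕ} {Q : ℝ[X]} (hα : 0 ≤ α) (h : IsJacobi α s Q) :
    0 < Q.eval 1 := by
  rw [h.2.2]
  have h1 : 0 < Real.Gamma (s + α + 1) := Real.Gamma_pos_of_pos (by positivity)
  have h2 : 0 < Real.Gamma (α + 1) := Real.Gamma_pos_of_pos (by positivity)
  positivity

lemma IsJacobi.integral_sq_pos {s : ℕ} {Q : ℝ[X]} (hα : 0 ≤ α) (h : IsJacobi α s Q) :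
    0 < gegenbauerIntegral α hα (Q ^ 2) := by
  have h0 : Q ≠ 0 := by rintro rfl; simpa using h.1
  refine gegenbauerIntegral_pos hα (fun t _ => ?_) (pow_ne_zero 2 h0)
  rw [eval_pow]
  exact sq_nonneg _

lemma IsJacobi.eq_one {Q : ℝ[X]} (hα : 0 ≤ α) (h : IsJacobi α 0 Q) : Q = 1 := by
  have h1 := h.2.2
  have h2 : 0 < Real.Gamma (α + 1) := Real.Gamma_pos_of_pos (by positivity)
  rw [eq_C_of_degree_le_zero h.1.le] at h1 ⊢
  rw [eval_C] at h1
  rw [h1]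
  simp [h2.ne']

lemma monotone_eval_one_sq_div (hα : 1 ≤ α) (hP : ∀ s, IsJacobi α s (P s)) :
    Monotone fun s => (P s).eval 1 ^ 2 / gegenbauerIntegral α (zero_le_one.trans hα) (P s ^ 2) := by
  have hα0 := zero_le_one.trans hα
  refine monotone_nat_of_le_succ fun s => ?_
  have h := (hP (s + 1)).orthBelow (hα := hα0)
  obtain ⟨κ, hκ⟩ := h.exists_ladder (hP (s + 1)).1 ((hP s).orthBelow (hα := hα0)) (hP s).1
  have hge := gegenbauerIntegral_ladder_ge hα h (hP (s + 1)).1 hκ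
  have e := congrArg (eval 1) hκ
  simp only [eval_add, eval_mul, eval_sub, eval_one, eval_pow, eval_X, eval_C] at e
  have hp := (hP s).eval_one_pos hα0
  have hN := (hP s).integral_sq_pos hα0
  have hN' := (hP (s + 1)).integral_sq_pos hα0
  rw [div_le_div_iff₀ hN hN']
  have e2 : ((s : ℝ) + 1) ^ 2 * (P (s + 1)).eval 1 ^ 2 = κ ^ 2 * (P s).eval 1 ^ 2 := by
    rw [← mul_pow, ← mul_pow]
    congr 1
    linarith
  have hs : (0 : ℝ) < ((s : ℝ) + 1) ^ 2 := by positivity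
  refine le_of_mul_le_mul_left ?_ hs
  calc ((s : ℝ) + 1) ^ 2 * ((P s).eval 1 ^ 2 * gegenbauerIntegral α hα0 (P (s + 1) ^ 2))
      = (P s).eval 1 ^ 2 * (((s : ℝ) + 1) ^ 2 * gegenbauerIntegral α hα0 (P (s + 1) ^ 2)) := by ring
    _ ≤ (P s).eval 1 ^ 2 * (κ ^ 2 * gegenbauerIntegral α hα0 (P s ^ 2)) := by gcongr
    _ = _ := by linear_combination -gegenbauerIntegral α hα0 (P s ^ 2) * e2

lemma root_le_root_of_le (hα : 0 ≤ α) (hP : ∀ s, IsJacobi α s (P s)) {x : ℕ → ℝ}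
    (hx : ∀ s, 1 ≤ s → IsGreatest {t : ℝ | (P s).eval t = 0} (x s)) {s r : ℕ} (hs : 1 ≤ s)
    (hsr : s ≤ r) : x s ≤ x r := by
  induction r, hsr using Nat.le_induction with
  | base => exact le_rfl
  | succ r hr ih =>
    exact ih.trans (((hP (r + 1)).orthBelow (hα := hα)).root_le_root_succ (hP (r + 1)).1
      (hP r).orthBelow (hP r).1 ((hP (r + 1)).eval_one_pos hα) (hx _ (by omega))
      (hx r (by omega)).1)

lemma exists_eq_sum_jacobi (hP : ∀ s, IsJacobi α s (P s)) {m : ℕ} {Q : ℝ[X]}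
    (hQ : Q.degree < m) : ∃ a : ℕ → ℝ, Q = ∑ s ∈ Finset.range m, C (a s) * P s := by
  induction m generalizing Q with
  | zero => exact ⟨0, by simpa [Nat.WithBot.lt_zero_iff] using hQ⟩
  | succ m ih =>
    have hm : (P m).coeff m ≠ 0 := coeff_ne_zero_of_eq_degree (hP m).1
    obtain ⟨a, ha⟩ := ih (Q := Q - C (Q.coeff m / (P m).coeff m) * P m) (by
      rw [degree_lt_iff_coeff_zero] at hQ ⊢
      intro j hj
      rw [coeff_sub, coeff_C_mul]
      rcases hj.eq_or_lt with rfl | hj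
      · field_simp
        ring
      · have hz : (P m).coeff j = 0 :=
          coeff_eq_zero_of_degree_lt (by rw [(hP m).1]; exact_mod_cast hj)
        rw [hQ j hj, hz]
        ring)
    refine ⟨Function.update a m (Q.coeff m / (P m).coeff m), ?_⟩
    rw [Finset.sum_range_succ, Function.update_self, ← sub_eq_iff_eq_add, ha]
    refine Finset.sum_congr rfl fun s hs => ?_
    rw [Function.update_of_ne (Finset.mem_range.1 hs).ne]

lemma integral_jacobi_mul_jacobi (hα : 0 ≤ α) (hP : ∀ s, IsJacobi α s (P s)) {i j : ℕ}
    (hij : i ≠ j) : gegenbauerIntegral α hα (P i * P j) = 0 := by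
  rcases hij.lt_or_gt with h | h
  · rw [mul_comm]
    exact (hP j).orthBelow _ ((hP i).1 ▸ by exact_mod_cast h)
  · exact (hP i).orthBelow _ ((hP j).1 ▸ by exact_mod_cast h)

lemma eq_sum_jacobi (hα : 0 ≤ α) (hP : ∀ s, IsJacobi α s (P s)) {m : ℕ} {Q : ℝ[X]}
    (hQ : Q.degree < m) :
    Q = ∑ s ∈ Finset.range m,
      C (gegenbauerIntegral α hα (P s * Q) / gegenbauerIntegral α hα (P s ^ 2)) * P s := by
  obtain ⟨a, ha⟩ := exists_eq_sum_jacobi hP hQ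
  nth_rw 1 [ha]
  refine Finset.sum_congr rfl fun s hs => ?_
  have hN := (hP s).integral_sq_pos hα
  congr 2
  rw [eq_div_iff hN.ne', ha, Finset.mul_sum, map_sum, Finset.sum_eq_single_of_mem s hs]
  · rw [mul_left_comm, ← smul_eq_C_mul, map_smul, smul_eq_mul, sq]
  · intro j _ hj
    rw [mul_left_comm, ← smul_eq_C_mul, map_smul, integral_jacobi_mul_jacobi hα hP hj.symm,
      smul_zero]

/-- A feasible polynomial is a multiple of `(t - δ)(1 + t)^m` for large `m`. -/
lemma exists_feasible (hα : 0 ≤ α) (hP : ∀ s, IsJacobi α s (P s)) {δ : ℝ} (h0 : 0 ≤ δ)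
    (h1 : δ < 1) :
    ∃ (m : ℕ) (a : ℕ → ℝ) (F : ℝ[X]), F = ∑ s ∈ Finset.range (m + 1), C (a s) * P s ∧
      (∀ s, 0 ≤ a s) ∧ a 0 = 1 ∧ ∀ t ∈ Icc (-1 : ℝ) δ, F.eval t ≤ 0 := by
  obtain ⟨m, hm⟩ := exists_nat_gt (2 * (α + 1) / (1 - δ))
  rw [div_lt_iff₀ (by linarith)] at hm
  set G : ℝ[X] := (1 + X) ^ (m + 1) - C (1 + δ) * (1 + X) ^ m with hG
  have hGint (s : ℕ) : gegenbauerIntegral α hα (P s * G) =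
      gegenbauerIntegral α hα (P s * (1 + X) ^ (m + 1)) -
        (1 + δ) * gegenbauerIntegral α hα (P s * (1 + X) ^ m) := by
    rw [hG, mul_sub, map_sub, mul_left_comm, ← smul_eq_C_mul, map_smul, smul_eq_mul]
  have hpos (s : ℕ) (hs : s ≤ m) : 0 < gegenbauerIntegral α hα (P s * G) := by
    have h := (hP s).orthBelow (hα := hα)
    have hI := h.integral_pow_one_add_X_pos_of_le (hP s).1 ((hP s).eval_one_pos hα) hs
    have e := h.integral_pow_one_add_X_succ (hP s).1 m
    have hsm : (s : ℝ) ≤ m := by exact_mod_cast hs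
    have hs0 : (0 : ℝ) ≤ s := Nat.cast_nonneg s
    have hA : 0 < ((m : ℝ) + 1) * (m + 2 * α + 2) - s * (s + 2 * α + 1) := by nlinarith
    have hA' : (1 + δ) * (((m : ℝ) + 1) * (m + 2 * α + 2) - s * (s + 2 * α + 1)) <
        2 * (m + 1) * (m + 1 + α) := by
      have : (1 + δ) * (((m : ℝ) + 1) * (m + 2 * α + 2) - s * (s + 2 * α + 1)) ≤
          (1 + δ) * (((m : ℝ) + 1) * (m + 2 * α + 2)) := by
        gcongr
        have : 0 ≤ (s : ℝ) * (s + 2 * α + 1) := by positivity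
        linarith
      nlinarith
    rw [hGint]
    refine (mul_pos_iff_of_pos_left hA).1 ?_
    nlinarith [mul_pos hI (sub_pos.2 hA')]
  have hnn (s : ℕ) : 0 ≤ gegenbauerIntegral α hα (P s * G) := by
    have h := (hP s).orthBelow (hα := hα)
    rcases (by omega : s ≤ m ∨ s = m + 1 ∨ m + 1 < s) with hs | rfl | hs
    · exact (hpos s hs).le
    · rw [hGint, h.integral_pow_one_add_X_eq_zero (Nat.lt_succ_self m), mul_zero, sub_zero]
      exact (h.integral_pow_one_add_X_pos_of_le (hP _).1 ((hP _).eval_one_pos hα) le_rfl).le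
    · rw [hGint, h.integral_pow_one_add_X_eq_zero hs,
        h.integral_pow_one_add_X_eq_zero (by omega)]
      simp
  have hGdeg : G.degree < (m + 2 : ℕ) := by
    rw [hG]
    have h2 (k : ℕ) : ((1 + X : ℝ[X]) ^ k).degree = k := by
      rw [add_comm, ← C_1, degree_pow, degree_X_add_C]; simp
    refine (degree_sub_le _ _).trans_lt (max_lt ?_ ?_)
    · rw [h2]
      norm_cast
      omega
    · rw [degree_C_mul (by linarith), h2]
      norm_cast
      omega
  set b : ℕ → ℝ := fun s =>
    gegenbauerIntegral α hα (P s * G) / gegenbauerIntegral α hα (P s ^ 2) with hb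
  have hb0 : 0 < b 0 := div_pos (hpos 0 (Nat.zero_le _)) ((hP 0).integral_sq_pos hα)
  refine ⟨m + 1, fun s => b s / b 0, C (b 0)⁻¹ * G, ?_,
    fun s => div_nonneg (div_nonneg (hnn s) ((hP s).integral_sq_pos hα).le) hb0.le,
    div_self hb0.ne', fun t ht => ?_⟩
  · conv_lhs => rw [eq_sum_jacobi hα hP hGdeg]
    rw [Finset.mul_sum]
    refine Finset.sum_congr rfl fun s _ => ?_
    rw [← mul_assoc, ← C_mul]
    congr 2
    exact (div_eq_inv_mul _ _).symm
  · have h2 : G.eval t = (t - δ) * (1 + t) ^ m := by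
      simp only [hG, eval_sub, eval_mul, eval_pow, eval_add, eval_one, eval_X, eval_C]
      ring
    rw [eval_mul, eval_C, h2]
    refine mul_nonpos_of_nonneg_of_nonpos (inv_nonneg.2 hb0.le)
      (mul_nonpos_of_nonpos_of_nonneg (by linarith [ht.2]) (pow_nonneg (by linarith [ht.1]) _))

end Sequence

section DualMeasure

variable {α : ℝ}

lemma OrthBelow.integral_tail_eq {hα : 0 ≤ α} {s : ℕ} {P : ℝ[X]} (h : OrthBelow hα s P)
    (hdeg : P.degree = s) {δ : ℝ} (h0 : 0 ≤ δ) (h1 : δ < 1) :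
    s * (s + 2 * α + 1) * ∫ t in δ..1, P.eval t * (1 - t ^ 2) ^ α =
      (1 - δ ^ 2) ^ α * (1 - δ ^ 2) * P.derivative.eval δ := by
  have e := integral_weightedDeriv hα (derivative P) (by linarith : -1 ≤ δ) h1.le le_rfl
  rw [h.weightedDeriv_derivative hdeg] at e
  simp only [eval_neg, eval_mul, eval_C, neg_mul, mul_assoc, intervalIntegral.integral_neg,
    intervalIntegral.integral_const_mul] at e
  rw [one_pow, sub_self, Real.zero_rpow (by linarith), zero_mul, zero_sub, neg_inj,
    Real.rpow_add_one (by nlinarith)] at e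
  linear_combination e

lemma eval_half_le_of_near {P : ℝ[X]} (hsp : P.Splits) (h1 : 0 < P.eval 1) {b δ q r : ℝ}
    (hb : ∀ z, P.eval z = 0 → z ≤ b) (hq : 0 < q) (hbδ : b + 2 / q ≤ δ) (hδ : δ < 1)
    (hr : 1 ≤ r) (hPr : (P.natDegree : ℝ) ≤ r) {t : ℝ} (ht : t ∈ Icc (δ - 1 / (2 * r * q)) δ) :
    P.eval δ / 2 ≤ P.eval t := by
  have hε : 1 / (2 * r * q) ≤ 1 / q := one_div_le_one_div_of_le hq (by nlinarith)
  have h2q : 2 / q = 1 / q + 1 / q := by ring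
  have hq' : 0 < 1 / q := by positivity
  have hgap {u : ℝ} (hu : t ≤ u) : 1 / q ≤ u - b := by linarith [ht.1]
  have hpos {u : ℝ} (hu : u ∈ Icc t δ) : 0 < P.eval u :=
    eval_pos_of_forall_root_le hb h1 (by linarith [hgap hu.1]) (hu.2.trans hδ.le)
  have hder {u : ℝ} (hu : u ∈ Icc t δ) := derivative_bounds_of_splits hsp hb
    (by linarith [hgap hu.1] : b < u) (hpos hu)
  have hmono : MonotoneOn (fun u => P.eval u) (Icc t δ) := by
    refine monotoneOn_of_deriv_nonneg (convex_Icc _ _) P.continuous.continuousOn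
      P.differentiable.differentiableOn fun u hu => ?_
    rw [Polynomial.deriv]
    exact (hder (interior_subset hu)).1
  have hδ0 : 0 < P.eval δ := hpos (right_mem_Icc.2 ht.2)
  have hmvt := (convex_Icc t δ).image_sub_le_mul_sub_of_deriv_le (f := fun u => P.eval u)
    P.continuous.continuousOn P.differentiable.differentiableOn (C := r * q * P.eval δ)
    (fun u hu => by
      have hu := interior_subset hu
      rw [Polynomial.deriv]
      obtain ⟨hd0, hd⟩ := hder hu
      have hu0 := (hpos hu).le
      have hle : P.eval u ≤ P.eval δ := hmono hu (right_mem_Icc.2 ht.2) hu.2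
      have hd' : P.derivative.eval u * (1 / q) ≤ r * P.eval δ := by
        calc P.derivative.eval u * (1 / q) ≤ P.derivative.eval u * (u - b) := by
              gcongr; exact hgap hu.1
          _ ≤ P.natDegree * P.eval u := hd
          _ ≤ r * P.eval δ := by gcongr
      rw [mul_one_div, div_le_iff₀ hq] at hd'
      linarith) t (left_mem_Icc.2 ht.2) δ (right_mem_Icc.2 ht.2) ht.2
  have hlen : δ - t ≤ 1 / (2 * r * q) := by linarith [ht.1]
  have : r * q * P.eval δ * (δ - t) ≤ P.eval δ / 2 := by
    calc r * q * P.eval δ * (δ - t) ≤ r * q * P.eval δ * (1 / (2 * r * q)) := by gcongr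
      _ = P.eval δ / 2 := by field_simp
  linarith

/-- Low degrees: the tail integral is dominated by the mass placed just left of `δ`. -/
lemma OrthBelow.integral_tail_le {hα : 0 ≤ α} {s r : ℕ} {P : ℝ[X]} (h : OrthBelow hα s P)
    (hdeg : P.degree = s) (h1 : 0 < P.eval 1) (hs : 1 ≤ s) (hsr : s ≤ r) {b δ q : ℝ}
    (hb : ∀ z, P.eval z = 0 → z ≤ b) (hq : 2 ≤ q) (hqα : q ^ 2 = 2 * α + 3)
    (hbδ : b + 2 / q ≤ δ) (h0 : 0 ≤ δ) (hδ : δ < 1) :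
    ∫ t in δ..1, P.eval t * (1 - t ^ 2) ^ α ≤
      4 * r * (1 - δ ^ 2) * (1 - δ ^ 2) ^ α * ∫ t in (δ - 1 / (2 * r * q))..δ, P.eval t := by
  have hs' : (1 : ℝ) ≤ s := by exact_mod_cast hs
  have hsr' : (s : ℝ) ≤ r := by exact_mod_cast hsr
  have hnat : P.natDegree = s := natDegree_eq_of_degree_eq_some hdeg
  have hq0 : 0 < q := by linarith
  have hr0 : (0 : ℝ) < r := by linarith
  have h2q : 0 < 2 / q := by positivity
  have hδ0 : 0 < P.eval δ := eval_pos_of_forall_root_le hb h1 (by linarith) hδ.le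
  have hw : 0 < (1 - δ ^ 2) ^ α := weight_pos α ⟨by linarith, hδ⟩
  have hy : 0 < 1 - δ ^ 2 := by nlinarith
  have hε : 0 < 1 / (2 * r * q) := by positivity
  obtain ⟨hd0, hd⟩ := derivative_bounds_of_splits (h.splits hdeg) hb
    (by linarith : b < δ) hδ0
  have hd' : P.derivative.eval δ ≤ s * q / 2 * P.eval δ := by
    have : P.derivative.eval δ * (2 / q) ≤ s * P.eval δ := by
      rw [← hnat]
      refine le_trans ?_ hd
      gcongr
      linarith
    rw [mul_div_assoc', div_le_iff₀ hq0] at this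
    linarith
  have htail : ∫ t in δ..1, P.eval t * (1 - t ^ 2) ^ α ≤
      (1 - δ ^ 2) ^ α * (1 - δ ^ 2) * P.eval δ / q := by
    have e := h.integral_tail_eq hdeg h0 hδ
    set I := ∫ t in δ..1, P.eval t * (1 - t ^ 2) ^ α
    have hI : s * (s + 2 * α + 1) * I ≤
        (s * (q ^ 2 / 2)) * ((1 - δ ^ 2) ^ α * (1 - δ ^ 2) * P.eval δ / q) := by
      calc s * (s + 2 * α + 1) * I
          ≤ (1 - δ ^ 2) ^ α * (1 - δ ^ 2) * (s * q / 2 * P.eval δ) := by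
            rw [e]; gcongr
        _ = _ := by field_simp
    have hI0 : 0 ≤ I := by
      have h3 : 0 ≤ s * (s + 2 * α + 1) * I := by rw [e]; positivity
      have h4 : (0 : ℝ) < s * (s + 2 * α + 1) := by positivity
      exact (mul_nonneg_iff_of_pos_left h4).1 h3
    have hc : (s : ℝ) * (q ^ 2 / 2) ≤ s * (s + 2 * α + 1) := by
      gcongr
      nlinarith
    exact le_of_mul_le_mul_left ((mul_le_mul_of_nonneg_right hc hI0).trans hI) (by positivity)
  have hint : 1 / (2 * r * q) * (P.eval δ / 2) ≤ ∫ t in (δ - 1 / (2 * r * q))..δ, P.eval t := by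
    have := intervalIntegral.integral_mono_on (μ := MeasureTheory.volume)
      (f := fun _ => P.eval δ / 2)
      (g := fun t => P.eval t) (by linarith : δ - 1 / (2 * r * q) ≤ δ)
      intervalIntegrable_const (P.continuous.intervalIntegrable _ _)
      fun t ht => eval_half_le_of_near (h.splits hdeg) h1 hb hq0 hbδ hδ (hs'.trans hsr')
        (hnat ▸ hsr') ht
    rw [intervalIntegral.integral_const, smul_eq_mul, sub_sub_cancel] at this
    exact this
  calc ∫ t in δ..1, P.eval t * (1 - t ^ 2) ^ α
      ≤ (1 - δ ^ 2) ^ α * (1 - δ ^ 2) * P.eval δ / q := htail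
    _ = 4 * r * (1 - δ ^ 2) * (1 - δ ^ 2) ^ α * (1 / (2 * r * q) * (P.eval δ / 2)) := by
        field_simp
        norm_num
    _ ≤ _ := by gcongr

lemma weight_anti {s t : ℝ} (hα : 0 ≤ α) (hs : 0 ≤ s) (hst : s ≤ t) (ht : t ≤ 1) :
    (1 - t ^ 2) ^ α ≤ (1 - s ^ 2) ^ α :=
  Real.rpow_le_rpow (by nlinarith) (by nlinarith) hα

lemma integral_sq_weight_le (hα : 0 ≤ α) (P : ℝ[X]) {a b : ℝ} (ha : -1 ≤ a) (hab : a ≤ b)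
    (hb : b ≤ 1) :
    ∫ t in a..b, P.eval t ^ 2 * (1 - t ^ 2) ^ α ≤ gegenbauerIntegral α hα (P ^ 2) := by
  have hint := intervalIntegrable_mul_weight hα (P ^ 2) (-1) 1
  rw [gegenbauerIntegral_apply]
  simp only [eval_pow] at hint ⊢
  refine intervalIntegral.integral_mono_interval ha hab hb ?_ hint
  filter_upwards [MeasureTheory.ae_restrict_mem measurableSet_Ioc] with t ht
  exact mul_nonneg (sq_nonneg _) (weight_nonneg α (Ioc_subset_Icc_self ht))

/-- Integrated form of the arithmetic-geometric mean inequality, replacing Cauchy-Schwarz. -/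
lemma integral_le_of_le_sq (hα : 0 ≤ α) {P : ℝ[X]} {f : ℝ → ℝ} {a b v N : ℝ}
    (hf : IntervalIntegrable f MeasureTheory.volume a b) (ha : -1 ≤ a) (hab : a ≤ b) (hb : b ≤ 1)
    (hlen : b - a ≤ 1) (hv : 0 < v) (hN : 0 < N) (hN2 : N ^ 2 = gegenbauerIntegral α hα (P ^ 2))
    (hle : ∀ t ∈ Icc a b,
      f t ≤ v / (2 * N) * (P.eval t ^ 2 * (1 - t ^ 2) ^ α) + N / (2 * v) * v ^ 2) :
    ∫ t in a..b, f t ≤ N * v := by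
  have hint := intervalIntegrable_mul_weight hα (P ^ 2) a b
  simp only [eval_pow] at hint
  calc ∫ t in a..b, f t
      ≤ ∫ t in a..b, (v / (2 * N) * (P.eval t ^ 2 * (1 - t ^ 2) ^ α) + N / (2 * v) * v ^ 2) :=
        intervalIntegral.integral_mono_on hab hf
          ((hint.const_mul _).add intervalIntegrable_const) hle
    _ = v / (2 * N) * (∫ t in a..b, P.eval t ^ 2 * (1 - t ^ 2) ^ α) +
          (b - a) * (N / (2 * v) * v ^ 2) := by
        rw [intervalIntegral.integral_add (hint.const_mul _) intervalIntegrable_const,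
          intervalIntegral.integral_const_mul, intervalIntegral.integral_const, smul_eq_mul]
    _ ≤ v / (2 * N) * N ^ 2 + 1 * (N / (2 * v) * v ^ 2) := by
        gcongr
        rw [hN2]
        exact integral_sq_weight_le hα P ha hab hb
    _ = N * v := by field_simp; norm_num

/-- High degrees: an `L²` bound for the tail and the mass placed just left of `δ`. -/
lemma integral_tail_sub_le (hα : 0 ≤ α) {P : ℝ[X]} {δ ε v N k : ℝ} (hε : 0 ≤ ε) (hε1 : ε ≤ 1)
    (hδε : 0 ≤ δ - ε) (hδ : δ < 1) (hv : 0 < v) (hv2 : v ^ 2 = (1 - δ ^ 2) ^ α) (hN : 0 < N)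
    (hN2 : N ^ 2 = gegenbauerIntegral α hα (P ^ 2)) (hk : 0 ≤ k) :
    (∫ t in δ..1, P.eval t * (1 - t ^ 2) ^ α) -
      k * (1 - δ ^ 2) ^ α * (∫ t in (δ - ε)..δ, P.eval t) ≤ N * v * (1 + k) := by
  have hamgm (p : ℝ) : |p| ≤ v / (2 * N) * p ^ 2 + N / (2 * v) := by
    rw [← sub_nonneg]
    have : v / (2 * N) * p ^ 2 + N / (2 * v) - |p| = (v * |p| - N) ^ 2 / (2 * N * v) := by
      rw [← sq_abs p]
      field_simp
      ring
    rw [this]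
    positivity
  have h1 : ∫ t in δ..1, P.eval t * (1 - t ^ 2) ^ α ≤ N * v := by
    refine integral_le_of_le_sq hα (intervalIntegrable_mul_weight hα P _ _) (by linarith) hδ.le
      le_rfl (by linarith) hv hN hN2 fun t ht => ?_
    have hw := weight_nonneg α (⟨by linarith [ht.1], ht.2⟩ : t ∈ Icc (-1 : ℝ) 1)
    have hwle := weight_anti hα (by linarith : 0 ≤ δ) ht.1 ht.2
    rw [hv2]
    calc P.eval t * (1 - t ^ 2) ^ α
        ≤ (v / (2 * N) * P.eval t ^ 2 + N / (2 * v)) * (1 - t ^ 2) ^ α :=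
          mul_le_mul_of_nonneg_right ((le_abs_self _).trans (hamgm _)) hw
      _ = v / (2 * N) * (P.eval t ^ 2 * (1 - t ^ 2) ^ α) + N / (2 * v) * (1 - t ^ 2) ^ α := by ring
      _ ≤ _ := by gcongr
  have h2 : ∫ t in (δ - ε)..δ, -((1 - δ ^ 2) ^ α * P.eval t) ≤ N * v := by
    refine integral_le_of_le_sq hα (P := P)
      ((by fun_prop : Continuous fun t => -((1 - δ ^ 2) ^ α * P.eval t)).intervalIntegrable _ _)
      (by linarith) (by linarith) hδ.le (by linarith) hv hN hN2 fun t ht => ?_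
    have hw := weight_nonneg α (⟨by linarith, hδ.le⟩ : δ ∈ Icc (-1 : ℝ) 1)
    have hwle := weight_anti hα (by linarith [ht.1] : 0 ≤ t) ht.2 hδ.le
    rw [hv2]
    calc -((1 - δ ^ 2) ^ α * P.eval t) = -P.eval t * (1 - δ ^ 2) ^ α := by ring
      _ ≤ (v / (2 * N) * P.eval t ^ 2 + N / (2 * v)) * (1 - δ ^ 2) ^ α :=
          mul_le_mul_of_nonneg_right ((neg_le_abs _).trans (hamgm _)) hw
      _ = v / (2 * N) * (P.eval t ^ 2 * (1 - δ ^ 2) ^ α) + N / (2 * v) * (1 - δ ^ 2) ^ α := by ring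
      _ ≤ _ := by gcongr
  rw [intervalIntegral.integral_neg, intervalIntegral.integral_const_mul] at h2
  nlinarith [mul_le_mul_of_nonneg_left h2 hk]

lemma one_div_le_integral_weight (hα : 1 ≤ α) {δ q : ℝ} (hq : 2 ≤ q) (hqα : q ^ 2 = 2 * α + 3)
    (hδq : 2 / q ≤ δ) (hδ : δ < 1) : 1 / q ≤ ∫ t in (-1 : ℝ)..δ, (1 - t ^ 2) ^ α := by
  have hα0 : 0 ≤ α := by linarith
  have hq0 : 0 < q := by linarith
  have hq1 : 1 / q ≤ 1 / 2 := one_div_le_one_div_of_le (by norm_num) hq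
  have hq2 : 0 < 1 / q := by positivity
  have h2q : 2 / q = 1 / q + 1 / q := by ring
  have hlow : ∀ t ∈ Icc (-(1 / q)) (1 / q), (1 : ℝ) / 2 ≤ (1 - t ^ 2) ^ α := by
    intro t ht
    have ht2 : t ^ 2 ≤ 1 / q ^ 2 := by
      rw [← one_div_pow]
      exact sq_le_sq' ht.1 ht.2
    have hq3 : 1 / q ^ 2 * (2 * α + 3) = 1 := by rw [← hqα]; field_simp
    have hb := one_add_mul_self_le_rpow_one_add (s := -t ^ 2) (p := α) (by nlinarith) hα
    rw [← sub_eq_add_neg] at hb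
    nlinarith [sq_nonneg t]
  calc 1 / q = ∫ _ in (-(1 / q))..(1 / q), (1 : ℝ) / 2 := by
        rw [intervalIntegral.integral_const, smul_eq_mul]; ring
    _ ≤ ∫ t in (-(1 / q))..(1 / q), (1 - t ^ 2) ^ α :=
        intervalIntegral.integral_mono_on (by linarith) intervalIntegrable_const
          ((continuous_weight hα0).intervalIntegrable _ _) hlow
    _ ≤ ∫ t in (-1 : ℝ)..δ, (1 - t ^ 2) ^ α := by
        refine intervalIntegral.integral_mono_interval (by linarith) (by linarith) (by linarith) ?_
          ((continuous_weight hα0).intervalIntegrable _ _)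
        filter_upwards [MeasureTheory.ae_restrict_mem measurableSet_Ioc] with t ht
        exact weight_nonneg α ⟨ht.1.le, ht.2.trans hδ.le⟩

/-- Integration against the measure `w(t) 1_{[-1, δ]} dt + K 1_{[δ - ε, δ]} dt`. -/
noncomputable def dualFunctional (α : ℝ) (hα : 0 ≤ α) (δ ε K : ℝ) : ℝ[X] →ₗ[ℝ] ℝ where
  toFun G := (∫ t in (-1 : ℝ)..δ, G.eval t * (1 - t ^ 2) ^ α) + K * ∫ t in (δ - ε)..δ, G.eval t
  map_add' G H := by
    simp only [eval_add, add_mul]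
    rw [intervalIntegral.integral_add (intervalIntegrable_mul_weight hα G _ _)
      (intervalIntegrable_mul_weight hα H _ _), intervalIntegral.integral_add
      (G.continuous.intervalIntegrable _ _) (H.continuous.intervalIntegrable _ _)]
    ring
  map_smul' c G := by
    simp only [eval_smul, smul_eq_mul, mul_assoc, RingHom.id_apply,
      intervalIntegral.integral_const_mul]
    ring

lemma dualFunctional_apply (hα : 0 ≤ α) (δ ε K : ℝ) (G : ℝ[X]) :
    dualFunctional α hα δ ε K G =
      (∫ t in (-1 : ℝ)..δ, G.eval t * (1 - t ^ 2) ^ α) + K * ∫ t in (δ - ε)..δ, G.eval t := rfl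

lemma dualFunctional_nonpos (hα : 0 ≤ α) {δ ε K : ℝ} (hε : 0 ≤ ε) (hδε : 0 ≤ δ - ε) (hδ : δ ≤ 1)
    (hK : 0 ≤ K) {F : ℝ[X]} (hF : ∀ t ∈ Icc (-1 : ℝ) δ, F.eval t ≤ 0) :
    dualFunctional α hα δ ε K F ≤ 0 := by
  have h1 : 0 ≤ ∫ t in (-1 : ℝ)..δ, -(F.eval t * (1 - t ^ 2) ^ α) :=
    intervalIntegral.integral_nonneg (by linarith) fun t ht => neg_nonneg.2
      (mul_nonpos_of_nonpos_of_nonneg (hF t ht) (weight_nonneg α ⟨ht.1, ht.2.trans hδ⟩))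
  have h2 : 0 ≤ ∫ t in (δ - ε)..δ, -F.eval t :=
    intervalIntegral.integral_nonneg (by linarith) fun t ht => neg_nonneg.2
      (hF t ⟨by linarith [ht.1], ht.2⟩)
  rw [intervalIntegral.integral_neg] at h1 h2
  rw [dualFunctional_apply]
  nlinarith [mul_nonneg hK h2]

lemma IsJacobi.dualFunctional_eq {s : ℕ} {P : ℝ[X]} (hα : 0 ≤ α) (h : IsJacobi α s P)
    (hs : 1 ≤ s) (δ ε K : ℝ) :
    dualFunctional α hα δ ε K P =
      -((∫ t in δ..1, P.eval t * (1 - t ^ 2) ^ α) - K * ∫ t in (δ - ε)..δ, P.eval t) := by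
  have h0 : gegenbauerIntegral α hα P = 0 := by
    have := h.orthBelow (hα := hα) 1 (by rw [degree_one]; exact_mod_cast hs)
    rwa [mul_one] at this
  rw [gegenbauerIntegral_apply, ← intervalIntegral.integral_add_adjacent_intervals
    (intervalIntegrable_mul_weight hα P (-1) δ) (intervalIntegrable_mul_weight hα P δ 1)] at h0
  rw [dualFunctional_apply]
  linarith

/-- Weak duality for the linear program. -/
lemma le_eval_one_of_dual {P : ℕ → ℝ[X]} {Λ : ℝ[X] →ₗ[ℝ] ℝ} {c : ℝ} (hc : 0 ≤ c)
    (h0 : P 0 = 1) (hdual : ∀ s, 0 ≤ (P s).eval 1 + c * Λ (P s)) {m : ℕ} {a : ℕ → ℝ} {F : ℝ[X]}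
    (hF : F = ∑ s ∈ Finset.range (m + 1), C (a s) * P s) (ha : ∀ s, 0 ≤ a s) (ha0 : a 0 = 1)
    (hΛ : Λ F ≤ 0) : c * Λ 1 ≤ F.eval 1 := by
  have e : F.eval 1 + c * Λ F =
      ∑ s ∈ Finset.range (m + 1), a s * ((P s).eval 1 + c * Λ (P s)) := by
    rw [hF, eval_finsetSum, map_sum, Finset.mul_sum, ← Finset.sum_add_distrib]
    refine Finset.sum_congr rfl fun s _ => ?_
    rw [← smul_eq_C_mul, map_smul, eval_smul, smul_eq_mul, smul_eq_mul]
    ring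
  have h1 := Finset.single_le_sum (f := fun s => a s * ((P s).eval 1 + c * Λ (P s)))
    (fun s _ => mul_nonneg (ha s) (hdual s)) (Finset.mem_range.2 (Nat.succ_pos m))
  simp only [ha0, h0, eval_one] at h1
  nlinarith

end DualMeasure

/-- The lower bound in terms of the parameter `α = (n - 3) / 2`, with `q = √n`. -/
theorem le_eval_one_of_feasible {α q δ : ℝ} (h1α : 1 ≤ α) (hα : 0 ≤ α) (hq : 2 ≤ q)
    (hqα : q ^ 2 = 2 * α + 3) (hδ : δ < 1) {P : ℕ → ℝ[X]} (hP : ∀ s, IsJacobi α s (P s))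
    {x : ℕ → ℝ} (hx : ∀ s, 1 ≤ s → IsGreatest {t : ℝ | (P s).eval t = 0} (x s)) {r : ℕ}
    (hr : 1 ≤ r) (hxr : x r ≤ δ - 2 / q) {v N : ℝ} (hv : 0 < v) (hv2 : v ^ 2 = (1 - δ ^ 2) ^ α)
    (hN : N = √(gegenbauerIntegral α hα (P r ^ 2))) {m : ℕ} {a : ℕ → ℝ} {F : ℝ[X]}
    (hF : F = ∑ s ∈ Finset.range (m + 1), C (a s) * P s) (ha : ∀ s, 0 ≤ a s) (ha0 : a 0 = 1)
    (hFδ : ∀ t ∈ Icc (-1) δ, F.eval t ≤ 0) :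
    (P r).eval 1 / N / (5 * r * v) * (1 / q) ≤ F.eval 1 := by
  have hr' : (1 : ℝ) ≤ r := by exact_mod_cast hr
  have hq0 : 0 < q := by linarith
  have hxr0 : 0 ≤ x r :=
    ((hP r).orthBelow (hα := hα)).nonneg_of_isGreatest_root (hP r).1 (hx r hr)
  have hδq : 2 / q ≤ δ := by linarith
  have hδ0 : 0 < δ := lt_of_lt_of_le (by positivity) hδq
  have hN_pos {s : ℕ} : 0 < √(gegenbauerIntegral α hα (P s ^ 2)) :=
    Real.sqrt_pos.2 ((hP s).integral_sq_pos hα)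
  have hN0 : 0 < N := hN ▸ hN_pos
  set ε := 1 / (2 * r * q) with hε
  set k := 4 * r * (1 - δ ^ 2) with hk
  have hδ2 : 0 < 1 - δ ^ 2 := by nlinarith
  have hε0 : 0 ≤ ε := by positivity
  have hεq : ε ≤ 1 / q := one_div_le_one_div_of_le hq0 (by nlinarith)
  have h1q : 1 / q ≤ 1 := (div_le_one hq0).2 (by linarith)
  have h2q : 2 / q = 1 / q + 1 / q := by ring
  have h1q0 : 0 < 1 / q := by positivity
  have hk0 : 0 ≤ k := by positivity
  have hk5 : 1 + k ≤ 5 * r := by nlinarith [mul_nonneg (zero_le_one.trans hr') (sq_nonneg δ)]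
  have hK0 : 0 ≤ k * (1 - δ ^ 2) ^ α := by positivity
  set Λ := dualFunctional α hα δ ε (k * (1 - δ ^ 2) ^ α) with hΛ
  have hΛ1 : 1 / q ≤ Λ 1 := by
    rw [hΛ, dualFunctional_apply]
    simp only [eval_one, one_mul, intervalIntegral.integral_const, smul_eq_mul, mul_one,
      sub_sub_cancel]
    linarith [one_div_le_integral_weight h1α hq hqα hδq hδ, mul_nonneg hK0 hε0]
  have hP0 : P 0 = 1 := (hP 0).eq_one hα
  have hPr := (hP r).eval_one_pos hα
  have hc : 0 ≤ (P r).eval 1 / N / (5 * r * v) := by positivity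
  have hdual (s : ℕ) : 0 ≤ (P s).eval 1 + (P r).eval 1 / N / (5 * r * v) * Λ (P s) := by
    have hPs := (hP s).eval_one_pos hα
    rcases Nat.eq_zero_or_pos s with rfl | hs
    · have : 0 ≤ Λ (P 0) := by rw [hP0]; exact h1q0.le.trans hΛ1
      positivity
    rw [hΛ, (hP s).dualFunctional_eq hα hs]
    rcases le_or_gt s r with hsr | hsr
    · have := ((hP s).orthBelow (hα := hα)).integral_tail_le (hP s).1 hPs hs hsr (b := x r)
        (fun z hz => ((hx s hs).2 hz).trans (root_le_root_of_le hα hP hx hs hsr)) hq hqα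
        (by linarith) hδ0.le hδ
      have := mul_nonneg hc (sub_nonneg.2 this)
      rw [neg_sub]
      linarith
    · set M := √(gegenbauerIntegral α hα (P s ^ 2)) with hM
      have hM0 : 0 < M := hN_pos
      have hM2 : M ^ 2 = gegenbauerIntegral α hα (P s ^ 2) :=
        Real.sq_sqrt ((hP s).integral_sq_pos hα).le
      have hN2 : N ^ 2 = gegenbauerIntegral α hα (P r ^ 2) := by
        rw [hN]; exact Real.sq_sqrt ((hP r).integral_sq_pos hα).le
      have htail := integral_tail_sub_le hα hε0 (hεq.trans h1q) (by linarith) hδ hv hv2 hM0 hM2 hk0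
      have hmono : (P r).eval 1 / N ≤ (P s).eval 1 / M := by
        have h := monotone_eval_one_sq_div h1α hP hsr.le
        simp only [← hM2, ← hN2, ← div_pow] at h
        exact le_of_sq_le_sq h (by positivity)
      have : (P r).eval 1 / N / (5 * r * v) * (M * v * (1 + k)) ≤ (P s).eval 1 :=
        calc (P r).eval 1 / N / (5 * r * v) * (M * v * (1 + k))
            ≤ (P s).eval 1 / M / (5 * r * v) * (M * v * (5 * r)) := by gcongr
          _ = (P s).eval 1 := by field_simp
      linarith [mul_le_mul_of_nonneg_left htail hc]
  refine le_trans ?_ (le_eval_one_of_dual hc hP0 hdual hF ha ha0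
    (dualFunctional_nonpos hα hε0 (by linarith) hδ.le hK0 hFδ))
  gcongr

/-- Proposition 1.1: for `n ≥ 7`, `M_LP(n,θ) ≥ Ω(1/(r√n)) (1/(1-δ²))^{(n-4)/4} P_r(1)/‖P_r‖₂`,
where `δ = cos θ` and `r = max{s : x_s ≤ δ - 2n^{-1/2}}`, `x_s` the maximal root of `P_s`. -/
theorem lp_code_lower_bound :
    ∃ c : ℝ, 0 < c ∧
      ∀ n : ℕ, 7 ≤ n →
      ∀ θ : ℝ, θ ∈ Set.Ioo 0 Real.pi →
      ∀ P : ℕ → Polynomial ℝ, (∀ s, IsJacobi (((n : ℝ) - 3) / 2) s (P s)) →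
      ∀ x : ℕ → ℝ, (∀ s, 1 ≤ s → IsGreatest {t : ℝ | (P s).eval t = 0} (x s)) →
      ∀ r : ℕ,
        IsGreatest {s : ℕ | 1 ≤ s ∧ x s ≤ Real.cos θ - 2 / Real.sqrt n} r →
      MLP θ P ≥ c * (1 / (r * Real.sqrt n)) *
        (1 / (1 - Real.cos θ ^ 2)) ^ (((n : ℝ) - 4) / 4) *
        ((P r).eval 1 / jNorm n (P r)) := by
  refine ⟨1 / 5, by norm_num, fun n hn θ hθ P hP x hx r hr => ?_⟩
  obtain ⟨⟨hr1, hxr⟩, -⟩ := hr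
  have hn' : (7 : ℝ) ≤ n := by exact_mod_cast hn
  set α : ℝ := ((n : ℝ) - 3) / 2 with hαdef
  set δ := Real.cos θ with hδdef
  have h1α : 1 ≤ α := by linarith
  have hα : 0 ≤ α := by linarith
  have hq : 2 ≤ √(n : ℝ) := Real.le_sqrt_of_sq_le (by linarith)
  have hqα : √(n : ℝ) ^ 2 = 2 * α + 3 := by
    rw [Real.sq_sqrt (by linarith)]
    linarith
  have hδ : δ < 1 := by
    have := Real.cos_lt_cos_of_nonneg_of_le_pi le_rfl hθ.2.le hθ.1
    rwa [Real.cos_zero] at this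
  have hxr0 : 0 ≤ x r :=
    ((hP r).orthBelow (hα := hα)).nonneg_of_isGreatest_root (hP r).1 (hx r hr1)
  have hδ0 : 0 ≤ δ := by
    have : 0 < 2 / √(n : ℝ) := by positivity
    linarith
  have hδ2 : 0 < 1 - δ ^ 2 := by nlinarith
  set v := (1 - δ ^ 2) ^ (α / 2) with hv
  have hv0 : 0 < v := Real.rpow_pos_of_pos hδ2 _
  have hv2 : v ^ 2 = (1 - δ ^ 2) ^ α := by
    rw [hv, ← Real.rpow_natCast, ← Real.rpow_mul hδ2.le]
    congr 1
    push_cast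
    ring
  have hN : jNorm n (P r) = √(gegenbauerIntegral α hα (P r ^ 2)) := by
    simp only [jNorm, jWeight, gegenbauerIntegral_apply, eval_pow, hαdef]
  have hvle : (1 / (1 - δ ^ 2)) ^ (((n : ℝ) - 4) / 4) ≤ 1 / v := by
    calc (1 / (1 - δ ^ 2)) ^ (((n : ℝ) - 4) / 4) ≤ (1 / (1 - δ ^ 2)) ^ (α / 2) :=
          Real.rpow_le_rpow_of_exponent_le ((one_le_div hδ2).2 (by nlinarith)) (by linarith)
      _ = 1 / v := by rw [Real.div_rpow zero_le_one hδ2.le, Real.one_rpow]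
  refine le_csInf ?_ ?_
  · obtain ⟨m, a, F, hF, ha, ha0, hFδ⟩ := exists_feasible hα hP hδ0 hδ
    exact ⟨_, m, a, F, hF, ha, ha0, hFδ, rfl⟩
  rintro _ ⟨m, a, F, hF, ha, ha0, hFδ, rfl⟩
  have hPr := (hP r).eval_one_pos hα
  calc 1 / 5 * (1 / (r * √(n : ℝ))) * (1 / (1 - δ ^ 2)) ^ (((n : ℝ) - 4) / 4) *
        ((P r).eval 1 / jNorm n (P r))
      ≤ 1 / 5 * (1 / (r * √(n : ℝ))) * (1 / v) * ((P r).eval 1 / jNorm n (P r)) := by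
        have : 0 ≤ jNorm n (P r) := Real.sqrt_nonneg _
        gcongr
    _ = (P r).eval 1 / jNorm n (P r) / (5 * r * v) * (1 / √(n : ℝ)) := by
        field_simp
    _ ≤ F.eval 1 :=
        le_eval_one_of_feasible h1α hα hq hqα hδ hP hx hr1 hxr hv0 hv2 hN hF ha ha0 hFδ
end

section
/- Let n ≥ 6 and k ≥ 1 be integers. Let ℓ = k if k is even and ℓ = k+1 if k is odd, and let ρ be the maximal root of the Jacobi polynomial P_ℓ^{((n−5)/2,(n−5)/2)}. Then there is an absolute constant C > 0 (independent of n and k) such that N_LP(n,k) ≤ C · k · (1/(1−ρ²))^{(n−2)/4} · P_ℓ(1)/‖P_ℓ‖₂. -/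
open Polynomial Set

/-- `N_LP(n,k)`: supremum of `1/a₀` over polynomials `F = Σ a_s P_s` with
`F ≥ 0` on `[-1,1]`, `F(1) = 1`, `a₀ > 0`, and `a_s ≤ 0` for `s ≥ k`. -/
noncomputable def NLP (k : ℕ) (P : ℕ → Polynomial ℝ) : ℝ :=
  sSup { y : ℝ | ∃ (m : ℕ) (a : ℕ → ℝ) (F : Polynomial ℝ),
    F = ∑ s ∈ Finset.range (m + 1), Polynomial.C (a s) * P s ∧
    (∀ t ∈ Set.Icc (-1 : ℝ) 1, 0 ≤ F.eval t) ∧ F.eval 1 = 1 ∧ 0 < a 0 ∧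
    (∀ s, k ≤ s → a s ≤ 0) ∧ y = 1 / a 0 }

namespace JacobiLP

/-- The integral `∫_{-1}^1 p(t) (1-t²)^α dt` as a linear functional of the polynomial `p`. -/
noncomputable def wInt (α : ℝ) (hα : 0 ≤ α) : ℝ[X] →ₗ[ℝ] ℝ where
  toFun p := ∫ t in (-1 : ℝ)..1, p.eval t * (1 - t ^ 2) ^ α
  map_add' p q := by
    have h : ∀ p : ℝ[X], IntervalIntegrable (fun t : ℝ => p.eval t * (1 - t ^ 2) ^ α)
        MeasureTheory.volume (-1) 1 := fun p =>
      (p.continuous.mul ((by fun_prop : Continuous fun t : ℝ => 1 - t ^ 2).rpow_const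
        fun _ => Or.inr hα)).intervalIntegrable _ _
    rw [← intervalIntegral.integral_add (h p) (h q)]
    simp only [eval_add, add_mul]
  map_smul' c p := by
    simp only [eval_smul, smul_eq_mul, RingHom.id_apply, mul_assoc,
      intervalIntegral.integral_const_mul]

variable {α : ℝ} {hα : 0 ≤ α}

lemma wInt_apply (p : ℝ[X]) :
    wInt α hα p = ∫ t in (-1 : ℝ)..1, p.eval t * (1 - t ^ 2) ^ α := rfl

lemma continuous_weight (hα : 0 ≤ α) : Continuous fun t : ℝ => (1 - t ^ 2) ^ α :=
  (by fun_prop : Continuous fun t : ℝ => 1 - t ^ 2).rpow_const fun _ => Or.inr hα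

lemma wInt_C_mul (c : ℝ) (p : ℝ[X]) : wInt α hα (C c * p) = c * wInt α hα p := by
  rw [← smul_eq_C_mul, map_smul, smul_eq_mul]

lemma wInt_mono {p q : ℝ[X]} (h : ∀ t ∈ Icc (-1 : ℝ) 1, p.eval t ≤ q.eval t) :
    wInt α hα p ≤ wInt α hα q := by
  rw [wInt_apply, wInt_apply]
  refine intervalIntegral.integral_mono_on (by norm_num)
    ((p.continuous.mul (continuous_weight hα)).intervalIntegrable _ _)
    ((q.continuous.mul (continuous_weight hα)).intervalIntegrable _ _) fun t ht => ?_
  exact mul_le_mul_of_nonneg_right (h t ht)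
    (Real.rpow_nonneg (by nlinarith [ht.1, ht.2]) _)

lemma wInt_eq_zero_of_comp_neg {p : ℝ[X]} (h : p.comp (-X) = -p) : wInt α hα p = 0 := by
  have h1 : wInt α hα (p.comp (-X)) = wInt α hα p := by
    rw [wInt_apply, wInt_apply]
    have := intervalIntegral.integral_comp_neg (a := (-1 : ℝ)) (b := 1)
      (fun t : ℝ => p.eval t * (1 - t ^ 2) ^ α)
    simpa using this
  rw [h, map_neg] at h1
  linarith

lemma wInt_mul_self_pos {p : ℝ[X]} (hp : p ≠ 0) : 0 < wInt α hα (p * p) := by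
  rw [wInt_apply]
  have hne : ∃ c ∈ Ioo (-1 : ℝ) 1, p.eval c ≠ 0 := by
    by_contra! hcon
    exact hp (p.eq_zero_of_infinite_isRoot
      ((Ioo_infinite (by norm_num : (-1 : ℝ) < 1)).mono fun t ht => hcon t ht))
  obtain ⟨c, hc, hc0⟩ := hne
  refine intervalIntegral.integral_pos (by norm_num)
    (((p * p).continuous.mul (continuous_weight hα)).continuousOn) (fun t ht => ?_)
    ⟨c, Ioo_subset_Icc_self hc, ?_⟩
  · rw [eval_mul]
    exact mul_nonneg (mul_self_nonneg _)
      (Real.rpow_nonneg (by nlinarith [ht.1, ht.2]) _)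
  · rw [eval_mul]
    exact mul_pos (mul_self_pos.2 hc0) (Real.rpow_pos_of_pos (by nlinarith [hc.1, hc.2]) _)

lemma hasDerivAt_weight_mul (b : ℝ) {t f' : ℝ} {f : ℝ → ℝ} (ht : 0 < 1 - t ^ 2)
    (hf : HasDerivAt f f' t) :
    HasDerivAt (fun x => (1 - x ^ 2) ^ b * f x)
      ((1 - t ^ 2) ^ (b - 1) * ((1 - t ^ 2) * f' - 2 * b * t * f t)) t := by
  have h1 : HasDerivAt (fun x : ℝ => 1 - x ^ 2) (-(2 * t)) t := by
    simpa using (hasDerivAt_pow 2 t).const_sub 1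
  refine ((h1.rpow_const (p := b) (Or.inl ht.ne')).mul hf).congr_deriv ?_
  have : (1 - t ^ 2) ^ b = (1 - t ^ 2) ^ (b - 1) * (1 - t ^ 2) := by
    rw [← Real.rpow_add_one ht.ne', sub_add_cancel]
  rw [this]; ring

lemma wInt_deriv (G : ℝ[X]) :
    wInt α hα ((1 - X ^ 2) * derivative G - C (2 * (α + 1)) * X * G) = 0 := by
  have key : ∀ t ∈ Ioo (-1 : ℝ) 1, HasDerivAt (fun x => (1 - x ^ 2) ^ (α + 1) * G.eval x)
      (((1 - X ^ 2) * derivative G - C (2 * (α + 1)) * X * G).eval t * (1 - t ^ 2) ^ α) t := by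
    intro t ht
    refine (hasDerivAt_weight_mul (α + 1) (by nlinarith [ht.1, ht.2])
      (G.hasDerivAt t)).congr_deriv ?_
    simp only [eval_sub, eval_mul, eval_one, eval_pow, eval_X, eval_C, add_sub_cancel_right]
    ring
  rw [wInt_apply, intervalIntegral.integral_eq_sub_of_hasDerivAt_of_le (by norm_num)
    (((continuous_weight (by linarith : 0 ≤ α + 1)).mul G.continuous).continuousOn) key
    ((Polynomial.continuous _).mul (continuous_weight hα) |>.intervalIntegrable _ _)]
  have : α + 1 ≠ 0 := by positivity
  simp [this]

/-- The differential equation satisfied by the Jacobi polynomial `P_s^{(α,α)}`. -/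
def JacobiODE (α : ℝ) (s : ℕ) (p : ℝ[X]) : Prop :=
  (1 - X ^ 2) * derivative (derivative p) =
    C (2 * (α + 1)) * X * derivative p - C ((s : ℝ) * (s + 2 * α + 1)) * p

lemma JacobiODE.coeff {s : ℕ} {p : ℝ[X]} (h : JacobiODE α s p) (i : ℕ) :
    ((i : ℝ) + 2) * (i + 1) * p.coeff (i + 2) =
      ((i : ℝ) * (i + 2 * α + 1) - s * (s + 2 * α + 1)) * p.coeff i := by
  have h1 := congrArg (fun q : ℝ[X] => q.coeff i) h
  simp only [mul_assoc, sub_mul, one_mul, coeff_sub, coeff_C_mul] at h1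
  rcases i with _ | _ | i
  · simp [coeff_derivative, pow_two, mul_assoc] at h1 ⊢
    linarith
  · simp [coeff_derivative, coeff_X_mul, pow_two, mul_assoc] at h1 ⊢
    linarith
  · simp [coeff_derivative, coeff_X_mul, pow_two, mul_assoc] at h1 ⊢
    linarith

lemma JacobiODE.eq_zero (hα : 0 ≤ α) {s : ℕ} {p : ℝ[X]} (h : JacobiODE α s p)
    (hd : p.degree < s) : p = 0 := by
  by_contra hp
  have hlt : p.natDegree < s := (natDegree_lt_iff_degree_lt hp).2 hd
  have h1 := h.coeff p.natDegree
  rw [coeff_eq_zero_of_natDegree_lt (by omega), mul_zero] at h1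
  have h2 : (p.natDegree : ℝ) < s := by exact_mod_cast hlt
  have h3 : p.coeff p.natDegree ≠ 0 := leadingCoeff_ne_zero.2 hp
  have h4 : (p.natDegree : ℝ) * (p.natDegree + 2 * α + 1) - s * (s + 2 * α + 1) < 0 := by
    have : (0 : ℝ) ≤ p.natDegree := Nat.cast_nonneg _
    nlinarith
  exact mul_ne_zero h4.ne h3 h1.symm

lemma JacobiODE.sub {s : ℕ} {p q : ℝ[X]} (hp : JacobiODE α s p) (hq : JacobiODE α s q) :
    JacobiODE α s (p - q) := by
  unfold JacobiODE at *
  simp only [derivative_sub, mul_sub, hp, hq]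
  ring

lemma JacobiODE.C_mul {s : ℕ} {p : ℝ[X]} (hp : JacobiODE α s p) (c : ℝ) :
    JacobiODE α s (C c * p) := by
  unfold JacobiODE at *
  simp only [derivative_C_mul]
  linear_combination (C c) * hp

lemma JacobiODE.comp_neg {s : ℕ} {p : ℝ[X]} (hp : JacobiODE α s p) :
    JacobiODE α s (p.comp (-X)) := by
  unfold JacobiODE at *
  have := congrArg (fun q : ℝ[X] => q.comp (-X)) hp
  simp only [mul_comp, sub_comp, one_comp, pow_comp, X_comp, C_comp] at this
  simp only [derivative_comp, derivative_neg, derivative_X, derivative_mul, derivative_one]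
  linear_combination this

lemma JacobiODE.eq_C_mul (hα : 0 ≤ α) {s : ℕ} {p q : ℝ[X]} (hp : JacobiODE α s p)
    (hq : JacobiODE α s q) (hdp : p.natDegree ≤ s) (hdq : q.natDegree = s) (hq0 : q ≠ 0) :
    p = C (p.coeff s / q.coeff s) * q := by
  rw [← sub_eq_zero]
  refine (hp.sub (hq.C_mul _)).eq_zero hα ?_
  have hc : q.coeff s ≠ 0 := by rw [← hdq]; exact leadingCoeff_ne_zero.2 hq0
  rw [degree_lt_iff_coeff_zero]
  intro m hm
  rcases hm.eq_or_lt with rfl | hm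
  · simp [hc]
  · rw [coeff_sub, coeff_C_mul, coeff_eq_zero_of_natDegree_lt (p := p) (n := m) (by omega),
      coeff_eq_zero_of_natDegree_lt (p := q) (n := m) (by omega), mul_zero, sub_zero]

section Orthogonality

lemma degree_C_mul_le (c : ℝ) (p : ℝ[X]) : (C c * p).degree ≤ p.degree := by
  rw [← smul_eq_C_mul]
  exact degree_smul_le c p

variable {s : ℕ} {P : ℝ[X]}

lemma natDegree_eq (h : IsJacobi α s P) : P.natDegree = s := natDegree_eq_of_degree_eq_some h.1

lemma ne_zero (h : IsJacobi α s P) : P ≠ 0 := by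
  rintro rfl
  simpa using h.1

lemma eval_one_pos (hα : 0 ≤ α) (h : IsJacobi α s P) : 0 < P.eval 1 := by
  rw [h.2.2]
  have : (0 : ℝ) < s.factorial := by exact_mod_cast s.factorial_pos
  have := Real.Gamma_pos_of_pos (by positivity : (0 : ℝ) < s + α + 1)
  have := Real.Gamma_pos_of_pos (by positivity : (0 : ℝ) < α + 1)
  positivity

lemma wInt_mul_eq_zero (h : IsJacobi α s P) {g : ℝ[X]} (hg : g.degree < s) :
    wInt α hα (P * g) = 0 := by
  rcases Nat.eq_zero_or_pos s with rfl | hs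
  · have : g = 0 := by simpa using hg
    simp [this]
  have hg' : g.natDegree < s := by
    rcases eq_or_ne g 0 with rfl | hg0
    · simpa using hs
    · exact (natDegree_lt_iff_degree_lt hg0).2 hg
  rw [g.as_sum_range' s hg', Finset.mul_sum, map_sum]
  refine Finset.sum_eq_zero fun j hj => ?_
  rw [← C_mul_X_pow_eq_monomial, mul_left_comm, wInt_C_mul, wInt_apply]
  simp only [eval_mul, eval_pow, eval_X]
  rw [h.2.1 j (Finset.mem_range.1 hj), mul_zero]

lemma jacobiODE (hα : 0 ≤ α) (h : IsJacobi α s P) : JacobiODE α s P := by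
  set R : ℝ[X] := (1 - X ^ 2) * derivative (derivative P) -
    (C (2 * (α + 1)) * X * derivative P - C ((s : ℝ) * (s + 2 * α + 1)) * P) with hR
  set L : ℝ[X] := (1 - X ^ 2) * derivative (derivative R) -
    C (2 * (α + 1)) * X * derivative R + C ((s : ℝ) * (s + 2 * α + 1)) * R with hL
  have hcoeff : ∀ p : ℝ[X], ∀ i : ℕ, ((1 - X ^ 2) * derivative (derivative p)).coeff i =
      ((i : ℝ) + 2) * (i + 1) * p.coeff (i + 2) - (i : ℝ) * (i - 1) * p.coeff i := by
    intro p i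
    rw [sub_mul, one_mul, coeff_sub]
    rcases i with _ | _ | i <;>
    · simp [coeff_derivative, pow_two, mul_assoc]
      try ring
  have hcoeff' : ∀ p : ℝ[X], ∀ i : ℕ, (C (2 * (α + 1)) * X * derivative p).coeff i =
      2 * (α + 1) * i * p.coeff i := by
    intro p i
    rw [mul_assoc, coeff_C_mul]
    rcases i with _ | i <;>
    · simp [coeff_derivative]
      try ring
  have hRdeg : R.degree < s := by
    rw [degree_lt_iff_coeff_zero]
    intro m hm
    have h0 : ∀ j, s < j → P.coeff j = 0 := fun j hj =>
      coeff_eq_zero_of_natDegree_lt (by rw [natDegree_eq h]; exact hj)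
    rw [hR, coeff_sub, coeff_sub, hcoeff, hcoeff', coeff_C_mul, h0 (m + 2) (by omega)]
    rcases hm.eq_or_lt with rfl | hm
    · ring
    · rw [h0 m hm]; ring
  have hLdeg : L.degree < s := by
    rw [degree_lt_iff_coeff_zero]
    intro m hm
    have h0 : ∀ j, s ≤ j → R.coeff j = 0 := (degree_lt_iff_coeff_zero _ _).1 hRdeg
    rw [hL, coeff_add, coeff_sub, hcoeff, hcoeff', coeff_C_mul, h0 (m + 2) (by omega), h0 m hm]
    ring
  have hsymm : wInt α hα (R * R) = wInt α hα (P * L) := by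
    have := wInt_deriv (hα := hα) (derivative P * R - P * derivative R)
    have heq : R * R - P * L = (1 - X ^ 2) * derivative (derivative P * R - P * derivative R) -
        C (2 * (α + 1)) * X * (derivative P * R - P * derivative R) := by
      simp only [derivative_sub, derivative_mul]
      rw [hL]
      nth_rewrite 1 [hR]
      ring
    rw [← heq, map_sub] at this
    linarith
  rw [wInt_mul_eq_zero h hLdeg] at hsymm
  have hR0 : R = 0 := by
    by_contra hne
    exact (wInt_mul_self_pos (hα := hα) hne).ne' hsymm
  exact sub_eq_zero.1 hR0

lemma comp_neg_eq (hα : 0 ≤ α) (h : IsJacobi α s P) : P.comp (-X) = C ((-1) ^ s) * P := by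
  have hode := jacobiODE hα h
  have hnd : (P.comp (-X)).natDegree = s := by
    rw [natDegree_comp, natDegree_neg, natDegree_X, mul_one, natDegree_eq h]
  rw [hode.comp_neg.eq_C_mul hα hode hnd.le (natDegree_eq h) (ne_zero h),
    (by simp : (-X : ℝ[X]) = C (-1) * X),
    comp_C_mul_X_coeff, mul_div_cancel_left₀]
  rw [← natDegree_eq h]
  exact leadingCoeff_ne_zero.2 (ne_zero h)

lemma eval_neg_eq (hα : 0 ≤ α) (h : IsJacobi α s P) (t : ℝ) :
    P.eval (-t) = (-1) ^ s * P.eval t := by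
  have := congrArg (eval t) (comp_neg_eq hα h)
  simpa [eval_comp] using this

lemma eq_one (h : IsJacobi α 0 P) (hα : 0 ≤ α) : P = 1 := by
  rw [eq_C_of_natDegree_eq_zero (natDegree_eq h)]
  have h1 := h.2.2
  rw [eq_C_of_natDegree_eq_zero (natDegree_eq h), eval_C] at h1
  have := (Real.Gamma_pos_of_pos (by positivity : (0 : ℝ) < α + 1)).ne'
  rw [h1]
  simp [this]

end Orthogonality

section Reproducing

variable {s : ℕ} {P : ℝ[X]}

lemma exists_eq_one_sub_sq_mul {g : ℝ[X]} (hg : g.comp (-X) = g) :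
    ∃ h : ℝ[X], g = C (g.eval 1) + (1 - X ^ 2) * h := by
  have h1 : (X - C 1) ∣ g - C (g.eval 1) := dvd_iff_isRoot.2 (by simp)
  have h2 : (X - C (-1)) ∣ g - C (g.eval 1) := by
    refine dvd_iff_isRoot.2 ?_
    have := congrArg (eval 1) hg
    simp only [eval_comp, eval_neg, eval_X] at this
    simp [this]
  have hco : IsCoprime (X - C (1 : ℝ)) (X - C (-1)) :=
    isCoprime_X_sub_C_of_isUnit_sub (by norm_num)
  obtain ⟨h, hh⟩ := hco.mul_dvd h1 h2
  refine ⟨-h, ?_⟩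
  rw [eq_add_of_sub_eq hh]
  simp only [C_neg, C_1, eval_add, eval_mul, eval_sub, eval_X, eval_one, sub_self, zero_mul, eval_C]
  simp
  ring

/-- Integration against `X * P'` evaluates even polynomials at `1`, up to the action of the
Euler operator. -/
lemma wInt_mul_X_mul_derivative {g : ℝ[X]} (hs : 1 ≤ s) (h : IsJacobi α s P)
    (hg : g.comp (-X) = g) (hd : g.natDegree ≤ s) :
    wInt α hα (g * (X * derivative P)) = wInt α hα (X * derivative P) * g.eval 1 -
      wInt α hα (P * (X * derivative g + C (2 * α + 1) * g)) := by
  obtain ⟨q, hq⟩ := exists_eq_one_sub_sq_mul hg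
  set c := g.eval 1
  have hqd : q.degree < s := by
    rcases eq_or_ne q 0 with rfl | hq0
    · simp
    rw [← natDegree_lt_iff_degree_lt hq0]
    have h1 : ((1 - X ^ 2 : ℝ[X]) * q).natDegree = 2 + q.natDegree := by
      have h2 : (1 - X ^ 2 : ℝ[X]).natDegree = 2 := by compute_degree!
      rw [natDegree_mul (fun h0 => by simp [h0] at h2) hq0, h2]
    have h2 : (g - C c).natDegree = 2 + q.natDegree := by
      rw [← h1]; congr 1; rw [hq]; ring
    rw [natDegree_sub_C] at h2
    omega
  have hC : wInt α hα (P * C (2 * α + 1) * C c) = 0 := by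
    rw [mul_assoc, ← C_mul]
    exact wInt_mul_eq_zero h (degree_C_le.trans_lt (by exact_mod_cast hs))
  have hQ : wInt α hα (P * (C (2 * α) * q)) = 0 :=
    wInt_mul_eq_zero h ((degree_C_mul_le _ _).trans_lt hqd)
  have hibp := wInt_deriv (hα := hα) (P * (X * q))
  have heq : (1 - X ^ 2) * derivative (P * (X * q)) - C (2 * (α + 1)) * X * (P * (X * q)) =
      g * (X * derivative P) - C c * (X * derivative P) +
        P * (X * derivative g + C (2 * α + 1) * g) - P * C (2 * α + 1) * C c
        - P * (C (2 * α) * q) := by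
    rw [hq]
    simp only [derivative_mul, derivative_X, derivative_add, derivative_C, derivative_sub,
      derivative_one, derivative_X_pow, C_mul, C_add, C_1]
    simp
    ring
  rw [heq, map_sub, map_sub, map_add, map_sub, wInt_C_mul, hC, hQ] at hibp
  linarith

lemma degree_X_mul_derivative_sub_lt (h : IsJacobi α s P) :
    (X * derivative P - C (s : ℝ) * P).degree < ((s : ℕ) : WithBot ℕ) := by
  rw [degree_lt_iff_coeff_zero]
  intro m hm
  have h0 : ∀ j, s < j → P.coeff j = 0 := fun j hj =>
    coeff_eq_zero_of_natDegree_lt (by rw [natDegree_eq h]; exact hj)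
  have h1 : (X * derivative P).coeff m = m * P.coeff m := by
    rcases m with _ | m
    · simp
    · simp [coeff_derivative]; ring
  rw [coeff_sub, coeff_C_mul, h1]
  rcases hm.eq_or_lt with rfl | hm
  · ring
  · rw [h0 m hm]; ring

lemma wInt_self_mul_X_mul_derivative (h : IsJacobi α s P) :
    wInt α hα (P * (X * derivative P)) = s * wInt α hα (P * P) := by
  have := wInt_mul_eq_zero (hα := hα) h (degree_X_mul_derivative_sub_lt h)
  rw [mul_sub, map_sub, mul_left_comm P (C _), wInt_C_mul] at this
  linarith

lemma wInt_X_mul_derivative (hs : 1 ≤ s) (hev : Even s) (h : IsJacobi α s P) :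
    wInt α hα (X * derivative P) * P.eval 1 = (2 * s + 2 * α + 1) * wInt α hα (P * P) := by
  have h1 := wInt_mul_X_mul_derivative (hα := hα) hs h
    (by rw [comp_neg_eq hα h, hev.neg_one_pow]; simp) (natDegree_eq h).le
  rw [wInt_self_mul_X_mul_derivative h, mul_add, map_add, wInt_self_mul_X_mul_derivative h,
    mul_left_comm, wInt_C_mul] at h1
  linarith

lemma wInt_mul_X_mul_derivative_of_lt {g : ℝ[X]} (h : IsJacobi α s P)
    (hg : g.comp (-X) = g) (hd : g.natDegree < s) :
    wInt α hα (g * (X * derivative P)) = wInt α hα (X * derivative P) * g.eval 1 := by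
  rw [wInt_mul_X_mul_derivative (by omega) h hg hd.le, wInt_mul_eq_zero h, sub_zero]
  refine (degree_add_le _ _).trans_lt (max_lt ?_ ?_)
  · refine (degree_le_natDegree).trans_lt ?_
    rcases Nat.eq_zero_or_pos g.natDegree with h0 | h0
    · rw [eq_C_of_natDegree_eq_zero h0]
      simp; omega
    · have h2 := natDegree_mul_le (p := (X : ℝ[X])) (q := derivative g)
      have h3 := natDegree_derivative_lt h0.ne'
      rw [natDegree_X] at h2
      exact_mod_cast (by omega : (X * derivative g).natDegree < s)
  · exact (degree_C_mul_le _ _).trans_lt (degree_le_natDegree.trans_lt (by exact_mod_cast hd))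

end Reproducing

section LargestRoot

variable {b : ℝ} {s : ℕ} {z : ℝ[X]} {ρ : ℝ}

lemma JacobiODE.eval (h : JacobiODE α s z) (t : ℝ) :
    (1 - t ^ 2) * (derivative (derivative z)).eval t =
      2 * (α + 1) * t * (derivative z).eval t - s * (s + 2 * α + 1) * z.eval t := by
  simpa using congrArg (Polynomial.eval t) h

lemma antitoneOn_weight_mul_derivative {c : ℝ} (hb : 0 ≤ b) (hc : 0 ≤ c) (hρ : -1 ≤ ρ)
    (hz : ∀ t, (1 - t ^ 2) * (derivative (derivative z)).eval t =
      2 * (b + 1) * t * (derivative z).eval t - c * z.eval t)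
    (hpos : ∀ t ∈ Icc ρ 1, 0 ≤ z.eval t) :
    AntitoneOn (fun t : ℝ => (1 - t ^ 2) ^ (b + 1) * (derivative z).eval t) (Icc ρ 1) := by
  have key : ∀ t ∈ Ioo ρ 1, HasDerivAt
      (fun t : ℝ => (1 - t ^ 2) ^ (b + 1) * (derivative z).eval t)
      (-((1 - t ^ 2) ^ b * (c * z.eval t))) t := by
    intro t ht
    refine (hasDerivAt_weight_mul (b + 1) (by nlinarith [ht.1, ht.2])
      ((derivative z).hasDerivAt t)).congr_deriv ?_
    rw [hz t, add_sub_cancel_right]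
    ring
  refine antitoneOn_of_deriv_nonpos (convex_Icc _ _)
    ((continuous_weight (by positivity)).mul (Polynomial.continuous _)).continuousOn ?_ ?_
  · rw [interior_Icc]
    exact fun t ht => (key t ht).differentiableAt.differentiableWithinAt
  · rw [interior_Icc]
    intro t ht
    rw [(key t ht).deriv]
    have h1 := hpos t (Ioo_subset_Icc_self ht)
    have h2 : 0 ≤ (1 - t ^ 2) ^ b := Real.rpow_nonneg (by nlinarith [ht.1, ht.2]) _
    have := mul_nonneg h2 (mul_nonneg hc h1)
    linarith

lemma derivative_nonneg {c : ℝ} (hb : 0 ≤ b) (hc : 0 ≤ c) (hρ : -1 < ρ)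
    (hz : ∀ t, (1 - t ^ 2) * (derivative (derivative z)).eval t =
      2 * (b + 1) * t * (derivative z).eval t - c * z.eval t)
    (hpos : ∀ t ∈ Icc ρ 1, 0 ≤ z.eval t) {t : ℝ} (ht : t ∈ Icc ρ 1) :
    0 ≤ (derivative z).eval t := by
  rcases ht.2.eq_or_lt with rfl | ht1
  · have h1 := hz 1
    have h2 := mul_nonneg hc (hpos 1 ht)
    have h3 : 0 < 2 * (b + 1) := by positivity
    refine nonneg_of_mul_nonneg_right (b := (derivative z).eval 1) ?_ h3
    nlinarith
  · have h1 := antitoneOn_weight_mul_derivative hb hc hρ.le hz hpos ht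
      (right_mem_Icc.2 (ht.1.trans ht.2)) ht.2
    have hb' : b + 1 ≠ 0 := by positivity
    simp only [one_pow, sub_self, Real.zero_rpow hb', zero_mul] at h1
    exact nonneg_of_mul_nonneg_right h1
      (Real.rpow_pos_of_pos (by nlinarith [ht.1, ht.2]) _)

lemma JacobiODE.eval_ne_zero_of_one_le (hb : 0 ≤ b) (hz : JacobiODE b s z)
    (h1 : z.eval 1 ≠ 0) {t : ℝ} (ht : 1 ≤ t) : z.eval t ≠ 0 := by
  have hmono : MonotoneOn (fun t : ℝ => (t ^ 2 - 1) ^ (b + 1) * (z.eval t * (derivative z).eval t))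
      (Ici 1) := by
    have key : ∀ t ∈ Ioi (1 : ℝ), HasDerivAt
        (fun t : ℝ => (t ^ 2 - 1) ^ (b + 1) * (z.eval t * (derivative z).eval t))
        ((t ^ 2 - 1) ^ b * ((t ^ 2 - 1) * (derivative z).eval t ^ 2 +
          s * (s + 2 * b + 1) * z.eval t ^ 2)) t := by
      intro t ht
      have ht' : 0 < t ^ 2 - 1 := by nlinarith [mem_Ioi.1 ht]
      have h2 : HasDerivAt (fun x : ℝ => x ^ 2 - 1) (2 * t) t := by
        simpa using (hasDerivAt_pow 2 t).sub_const 1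
      refine ((h2.rpow_const (p := b + 1) (Or.inl ht'.ne')).mul
        ((z.hasDerivAt t).mul ((derivative z).hasDerivAt t))).congr_deriv ?_
      simp only [Pi.mul_apply]
      rw [add_sub_cancel_right, Real.rpow_add_one ht'.ne']
      linear_combination (-((t ^ 2 - 1) ^ b * z.eval t)) * hz.eval t
    refine monotoneOn_of_deriv_nonneg (convex_Ici _) ?_ ?_ ?_
    · exact (((by fun_prop : Continuous fun t : ℝ => t ^ 2 - 1).rpow_const
        fun _ => Or.inr (by positivity)).mul (z.continuous.mul
          (Polynomial.continuous _))).continuousOn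
    · rw [interior_Ici]
      exact fun t ht => (key t ht).differentiableAt.differentiableWithinAt
    · rw [interior_Ici]
      intro t ht
      rw [(key t ht).deriv]
      have ht' : 0 ≤ t ^ 2 - 1 := by nlinarith [mem_Ioi.1 ht]
      have : 0 ≤ (t ^ 2 - 1) ^ b := Real.rpow_nonneg ht' _
      positivity
  have hsq : MonotoneOn (fun t : ℝ => z.eval t ^ 2) (Ici 1) := by
    refine monotoneOn_of_deriv_nonneg (convex_Ici _) (z.continuous.pow 2).continuousOn
      ((z.differentiable.pow 2).differentiableOn) ?_
    rw [interior_Ici]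
    intro t ht
    have h2 := hmono self_mem_Ici (mem_Ioi.1 ht).le (mem_Ioi.1 ht).le
    have hb' : b + 1 ≠ 0 := by positivity
    simp only [one_pow, sub_self, Real.zero_rpow hb', zero_mul] at h2
    have h3 := nonneg_of_mul_nonneg_right h2
      (Real.rpow_pos_of_pos (by nlinarith [mem_Ioi.1 ht]) _)
    rw [((z.hasDerivAt t).fun_pow 2).deriv]
    push_cast
    nlinarith
  intro h0
  have h2 := hsq self_mem_Ici ht ht
  simp only [h0] at h2
  have : 0 < z.eval 1 ^ 2 := by positivity
  linarith

variable (hb : 0 < b) (hz : JacobiODE b s z) (h1 : 0 < z.eval 1)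
  (hρ : IsGreatest {t : ℝ | z.eval t = 0} ρ)
include hb hz h1 hρ

lemma largestRoot_lt_one : ρ < 1 := by
  by_contra! h
  exact hz.eval_ne_zero_of_one_le hb.le h1.ne' h hρ.1

omit hb hz in
lemma eval_pos_of_largestRoot_lt {t : ℝ} (ht : ρ < t) (ht1 : t ≤ 1) : 0 < z.eval t := by
  by_contra! h
  obtain ⟨u, hu, hu0⟩ := intermediate_value_Icc ht1 z.continuous.continuousOn ⟨h, h1.le⟩
  have := hρ.2 hu0
  linarith [hu.1]

omit hb hz in
lemma eval_nonneg_of_largestRoot_le {t : ℝ} (ht : t ∈ Icc ρ 1) : 0 ≤ z.eval t := by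
  rcases ht.1.eq_or_lt with rfl | h
  · exact hρ.1.ge
  · exact (eval_pos_of_largestRoot_lt h1 hρ h ht.2).le

lemma derivative_eval_largestRoot_pos (hρ0 : 0 ≤ ρ) : 0 < (derivative z).eval ρ := by
  have hρ1 := largestRoot_lt_one hb hz h1 hρ
  have hanti := antitoneOn_weight_mul_derivative (c := s * (s + 2 * b + 1)) hb.le (by positivity)
    (by linarith) hz.eval (fun t ht => eval_nonneg_of_largestRoot_le h1 hρ ht)
  obtain ⟨ξ, hξ, hξ'⟩ := exists_deriv_eq_slope (fun t => z.eval t) hρ1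
    z.continuous.continuousOn z.differentiable.differentiableOn
  rw [z.deriv, hρ.1, sub_zero] at hξ'
  have h2 : 0 < (derivative z).eval ξ := by
    rw [hξ']
    exact div_pos h1 (by linarith)
  have h3 := hanti (left_mem_Icc.2 hρ1.le) (Ioo_subset_Icc_self hξ) hξ.1.le
  have h4 : 0 < (1 - ξ ^ 2) ^ (b + 1) :=
    Real.rpow_pos_of_pos (by nlinarith [hξ.1, hξ.2]) _
  have h5 : 0 < (1 - ρ ^ 2) ^ (b + 1) := Real.rpow_pos_of_pos (by nlinarith) _
  exact pos_of_mul_pos_right ((mul_pos h4 h2).trans_le h3) h5.le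

lemma largestRoot_sq_le (hρ0 : 0 ≤ ρ) :
    b ^ 2 * ρ ^ 2 ≤ s * (s + 2 * b + 1) * (1 - ρ ^ 2) := by
  have hρ1 := largestRoot_lt_one hb hz h1 hρ
  by_contra! hcon
  have key : ∀ t ∈ Ioo ρ 1, HasDerivAt
      (fun t : ℝ => (1 - t ^ 2) ^ b * ((1 - t ^ 2) * (z.eval t * (derivative z).eval t) -
        b * ρ * z.eval t ^ 2))
      ((1 - t ^ 2) ^ (b - 1) * (((1 - t ^ 2) * (derivative z).eval t - b * ρ * z.eval t) ^ 2 +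
        z.eval t ^ 2 * (2 * b ^ 2 * ρ * t - b ^ 2 * ρ ^ 2 -
          s * (s + 2 * b + 1) * (1 - t ^ 2)))) t := by
    intro t ht
    have h2 : HasDerivAt (fun x : ℝ => 1 - x ^ 2) (-(2 * t)) t := by
      simpa using (hasDerivAt_pow 2 t).const_sub 1
    refine (hasDerivAt_weight_mul b (by nlinarith [ht.1, ht.2])
      ((h2.mul ((z.hasDerivAt t).mul ((derivative z).hasDerivAt t))).sub
        (((z.hasDerivAt t).fun_pow 2).const_mul (b * ρ)))).congr_deriv ?_
    simp only [Pi.mul_apply, Pi.sub_apply]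
    push_cast
    linear_combination ((1 - t ^ 2) ^ (b - 1) * (1 - t ^ 2) * z.eval t) * hz.eval t
  have hmono : StrictMonoOn (fun t : ℝ => (1 - t ^ 2) ^ b * ((1 - t ^ 2) *
      (z.eval t * (derivative z).eval t) - b * ρ * z.eval t ^ 2)) (Icc ρ 1) := by
    refine strictMonoOn_of_deriv_pos (convex_Icc _ _)
      ((continuous_weight hb.le).mul (by fun_prop)).continuousOn ?_
    rw [interior_Icc]
    intro t ht
    rw [(key t ht).deriv]
    have h2 := eval_pos_of_largestRoot_lt h1 hρ ht.1 ht.2.le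
    have h3 : 0 < (1 - t ^ 2) ^ (b - 1) :=
      Real.rpow_pos_of_pos (by nlinarith [ht.1, ht.2]) _
    have h4 : 0 < 2 * b ^ 2 * ρ * t - b ^ 2 * ρ ^ 2 - s * (s + 2 * b + 1) * (1 - t ^ 2) := by
      have h5 : (s : ℝ) * (s + 2 * b + 1) * (1 - t ^ 2) ≤ s * (s + 2 * b + 1) * (1 - ρ ^ 2) :=
        mul_le_mul_of_nonneg_left (by nlinarith [ht.1]) (by positivity)
      have h6 : b ^ 2 * ρ * ρ ≤ b ^ 2 * ρ * t :=
        mul_le_mul_of_nonneg_left ht.1.le (by positivity)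
      nlinarith
    exact mul_pos h3 (add_pos_of_nonneg_of_pos (sq_nonneg _) (mul_pos (by positivity) h4))
  have h2 := hmono (left_mem_Icc.2 hρ1.le) (right_mem_Icc.2 hρ1.le) hρ1
  have h3 : z.eval ρ = 0 := hρ.1
  simp [h3, Real.zero_rpow hb.ne'] at h2

omit hb h1 hρ in
/-- Raising the parameter of the Jacobi differential equation by one. -/
lemma JacobiODE.raise : JacobiODE (b + 1) s (X * derivative z + C (s + 2 * b + 1) * z) := by
  have h2 := congrArg derivative hz
  unfold JacobiODE at *
  simp only [derivative_mul, derivative_sub, derivative_zero, derivative_one, derivative_X,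
    derivative_C, derivative_X_pow, map_add, map_mul, map_one] at *
  simp only [map_ofNat, map_natCast] at *
  push_cast at *
  linear_combination (X : ℝ[X]) * h2 + ((s : ℝ[X]) + 2 * C b + 3) * hz

end LargestRoot

section Kernel

variable {b : ℝ} {s : ℕ} {y z : ℝ[X]} {ρ : ℝ}

lemma JacobiODE.eval_derivative (h : JacobiODE α s y) (t : ℝ) :
    (1 - t ^ 2) * (derivative (derivative (derivative y))).eval t =
      2 * (α + 1 + 1) * t * (derivative (derivative y)).eval t -
        (s * (s + 2 * α + 1) - 2 * (α + 1)) * (derivative y).eval t := by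
  have := congrArg (fun p : ℝ[X] => (derivative p).eval t) h
  simp at this
  linear_combination this

lemma X_mul_derivative_le (hα : 0 ≤ α) (hs : 1 ≤ s) (hy : JacobiODE α s y) (hρ0 : 0 ≤ ρ)
    (hpos : ∀ t ∈ Icc ρ 1, 0 < y.eval t) {B : ℝ}
    (hB : ρ * (derivative y).eval ρ = B * y.eval ρ) {t : ℝ} (ht : t ∈ Icc ρ 1) :
    t * (derivative y).eval t ≤ B * y.eval t := by
  have hs' : (1 : ℝ) ≤ s := by exact_mod_cast hs
  have hρ1 : ρ ≤ 1 := ht.1.trans ht.2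
  have hy1 : ∀ t ∈ Icc ρ 1, 0 ≤ (derivative y).eval t := fun t ht =>
    derivative_nonneg hα (by positivity) (by linarith) hy.eval (fun t ht => (hpos t ht).le) ht
  have hy2 : ∀ t ∈ Icc ρ 1, 0 ≤ (derivative (derivative y)).eval t := fun t ht =>
    derivative_nonneg (b := α + 1) (by positivity) (by nlinarith) (by linarith)
      hy.eval_derivative hy1 ht
  have hinn : ∀ t : ℝ, HasDerivAt (fun t => y.eval t * (derivative y).eval t +
      t * y.eval t * (derivative (derivative y)).eval t - t * (derivative y).eval t ^ 2)
      (2 * y.eval t * (derivative (derivative y)).eval t +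
        t * y.eval t * (derivative (derivative (derivative y))).eval t -
        t * (derivative y).eval t * (derivative (derivative y)).eval t) t := by
    intro t
    have h0 := y.hasDerivAt t
    have h1 := (derivative y).hasDerivAt t
    have h2 := (derivative (derivative y)).hasDerivAt t
    refine (((h0.mul h1).add (((hasDerivAt_id t).mul h0).mul h2)).sub
      ((hasDerivAt_id t).mul (h1.fun_pow 2))).congr_deriv ?_
    simp only [Pi.mul_apply, id]
    push_cast
    ring
  have key : ∀ t ∈ Ioo ρ 1, HasDerivAt (fun t => (1 - t ^ 2) ^ (α + 1) *
      (y.eval t * (derivative y).eval t + t * y.eval t * (derivative (derivative y)).eval t -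
        t * (derivative y).eval t ^ 2))
      ((1 - t ^ 2) ^ α * (2 * y.eval t * (derivative (derivative y)).eval t)) t := by
    intro t ht
    refine (hasDerivAt_weight_mul (α + 1) (by nlinarith [ht.1, ht.2]) (hinn t)).congr_deriv ?_
    rw [add_sub_cancel_right]
    congr 1
    linear_combination (t * y.eval t) * hy.eval_derivative t +
      (-(t * (derivative y).eval t)) * hy.eval t
  have hmono : MonotoneOn (fun t => (1 - t ^ 2) ^ (α + 1) *
      (y.eval t * (derivative y).eval t + t * y.eval t * (derivative (derivative y)).eval t -
        t * (derivative y).eval t ^ 2)) (Icc ρ 1) := by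
    refine monotoneOn_of_deriv_nonneg (convex_Icc _ _)
      ((continuous_weight (by positivity)).mul (by fun_prop)).continuousOn ?_ ?_
    · rw [interior_Icc]
      exact fun t ht => (key t ht).differentiableAt.differentiableWithinAt
    · rw [interior_Icc]
      intro t ht
      rw [(key t ht).deriv]
      have h1 := hpos t (Ioo_subset_Icc_self ht)
      have h2 := hy2 t (Ioo_subset_Icc_self ht)
      have h3 : 0 ≤ (1 - t ^ 2) ^ α := Real.rpow_nonneg (by nlinarith [ht.1, ht.2]) _
      positivity
  have hquot : AntitoneOn (fun t => t * (derivative y).eval t / y.eval t) (Icc ρ 1) := by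
    have hd : ∀ t ∈ Ioo ρ 1, HasDerivAt (fun t => t * (derivative y).eval t / y.eval t)
        ((y.eval t * (derivative y).eval t + t * y.eval t * (derivative (derivative y)).eval t -
        t * (derivative y).eval t ^ 2) / y.eval t ^ 2) t := by
      intro t ht
      refine (((hasDerivAt_id t).mul ((derivative y).hasDerivAt t)).div (y.hasDerivAt t)
        (hpos t (Ioo_subset_Icc_self ht)).ne').congr_deriv ?_
      simp only [Pi.mul_apply, id]
      ring
    refine antitoneOn_of_deriv_nonpos (convex_Icc _ _)
      (ContinuousOn.div (by fun_prop) (by fun_prop) fun t ht => (hpos t ht).ne') ?_ ?_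
    · rw [interior_Icc]
      exact fun t ht => (hd t ht).differentiableAt.differentiableWithinAt
    · rw [interior_Icc]
      intro t ht
      rw [(hd t ht).deriv]
      have h1 := hmono (Ioo_subset_Icc_self ht) (right_mem_Icc.2 hρ1) ht.2.le
      have hα' : α + 1 ≠ 0 := by positivity
      simp only [one_pow, sub_self, Real.zero_rpow hα', zero_mul] at h1
      have h2 := nonpos_of_mul_nonpos_right h1
        (Real.rpow_pos_of_pos (by nlinarith [ht.1, ht.2] : 0 < 1 - t ^ 2) _)
      exact div_nonpos_of_nonpos_of_nonneg h2 (sq_nonneg _)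
  have h1 := hquot (left_mem_Icc.2 hρ1) ht ht.1
  simp only [hB, mul_div_cancel_right₀ _ (hpos ρ (left_mem_Icc.2 hρ1)).ne'] at h1
  rwa [div_le_iff₀ (hpos t ht)] at h1

/-- Facts about `P_s^{(b+1,b+1)}` beyond the largest root `ρ` of `P_s^{(b,b)}`. -/
lemma eval_pos_and_X_mul_derivative_eval (hb : 0 < b) (hz : JacobiODE b s z) (h1 : 0 < z.eval 1)
    (hρ : IsGreatest {t : ℝ | z.eval t = 0} ρ) (hρ0 : 0 < ρ)
    (hy : JacobiODE (b + 1) s y) (hy1 : 0 < y.eval 1) (hyd : y.natDegree = s)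
    (hzd : z.natDegree = s) :
    (∀ t ∈ Icc ρ 1, 0 < y.eval t) ∧
      ρ * (derivative y).eval ρ = (s + (2 * b + 2) / (1 - ρ ^ 2)) * y.eval ρ := by
  have hρ1 := largestRoot_lt_one hb hz h1 hρ
  have hz0 : ∀ t ∈ Icc ρ 1, 0 ≤ z.eval t := fun t ht => eval_nonneg_of_largestRoot_le h1 hρ ht
  have hy0 : y ≠ 0 := by rintro rfl; simp at hy1
  set x : ℝ[X] := X * derivative z + C (s + 2 * b + 1) * z with hx
  have hxe : ∀ t, x.eval t = t * (derivative z).eval t + (s + 2 * b + 1) * z.eval t := by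
    intro t; simp [hx]
  have hxpos : ∀ t ∈ Icc ρ 1, 0 < x.eval t := by
    intro t ht
    rw [hxe]
    rcases ht.1.eq_or_lt with rfl | hlt
    · have := mul_pos hρ0 (derivative_eval_largestRoot_pos hb hz h1 hρ hρ0.le)
      rw [show z.eval ρ = 0 from hρ.1]
      linarith
    · have h2 := derivative_nonneg hb.le (by positivity) (by linarith) hz.eval hz0 ht
      have h3 := eval_pos_of_largestRoot_lt h1 hρ hlt ht.2
      have h4 : 0 < t := hρ0.trans hlt
      positivity
  have hxd : x.natDegree ≤ s := by
    refine natDegree_add_le_of_degree_le 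
      (natDegree_le_iff_coeff_eq_zero.2 fun m hm => ?_) ?_
    · rcases m with _ | m
      · simp
      · rw [coeff_X_mul, coeff_derivative, coeff_eq_zero_of_natDegree_lt (by omega), zero_mul]
    · exact (natDegree_C_mul_le _ _).trans hzd.le
  obtain ⟨d, hd⟩ : ∃ d, x = C d * y := ⟨_, hz.raise.eq_C_mul (by positivity) hy hxd hyd hy0⟩
  have hd0 : 0 < d := by
    have h2 := hxpos 1 (right_mem_Icc.2 hρ1.le)
    rw [hd, eval_mul, eval_C] at h2
    exact pos_of_mul_pos_left h2 hy1.le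
  have hρ' : 0 < 1 - ρ ^ 2 := by nlinarith
  refine ⟨fun t ht => ?_, ?_⟩
  · have h2 := hxpos t ht
    rw [hd, eval_mul, eval_C] at h2
    exact pos_of_mul_pos_right h2 hd0.le
  · have h2 : (1 - ρ ^ 2) * (ρ * (derivative x).eval ρ) =
        (s * (1 - ρ ^ 2) + (2 * b + 2)) * x.eval ρ := by
      have h3 : (derivative x).eval ρ = (derivative z).eval ρ +
          ρ * (derivative (derivative z)).eval ρ + (s + 2 * b + 1) * (derivative z).eval ρ := by
        simp [hx]
      have h4 := hz.eval ρ
      rw [show z.eval ρ = 0 from hρ.1] at h4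
      rw [hxe, h3, show z.eval ρ = 0 from hρ.1]
      linear_combination ρ ^ 2 * h4
    rw [hd, derivative_C_mul, eval_mul, eval_mul, eval_C] at h2
    have h5 : (1 - ρ ^ 2) * (ρ * (derivative y).eval ρ) =
        (s * (1 - ρ ^ 2) + (2 * b + 2)) * y.eval ρ :=
      mul_left_cancel₀ hd0.ne' (by linear_combination h2)
    field_simp
    linear_combination h5

end Kernel

section SupBound

variable {l : ℝ} {s : ℕ} {y : ℝ[X]}

lemma JacobiODE.eval_of_sub_half (hy : JacobiODE (l - 1 / 2) s y) (t : ℝ) :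
    (1 - t ^ 2) * (derivative (derivative y)).eval t =
      (2 * l + 1) * t * (derivative y).eval t - s * (s + 2 * l) * y.eval t := by
  rw [hy.eval t]; ring

/-- The numerator `A` in `d/dt ((1-t²)^(l/2) y) = (1-t²)^(l/2-1) A`. -/
noncomputable def slope (l : ℝ) (y : ℝ[X]) (t : ℝ) : ℝ :=
  (1 - t ^ 2) * (derivative y).eval t - l * t * y.eval t

/-- The energy of the normal form of the Jacobi equation. -/
noncomputable def energy (l : ℝ) (s : ℕ) (y : ℝ[X]) (t : ℝ) : ℝ :=
  slope l y t ^ 2 + ((s + l) ^ 2 * (1 - t ^ 2) - l * (l - 1)) * y.eval t ^ 2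

lemma hasDerivAt_one_sub_sq (t : ℝ) : HasDerivAt (fun x : ℝ => 1 - x ^ 2) (-(2 * t)) t := by
  simpa using (hasDerivAt_pow 2 t).const_sub 1

lemma hasDerivAt_slope (hy : JacobiODE (l - 1 / 2) s y) (t : ℝ) :
    HasDerivAt (slope l y)
      ((l - 1) * t * (derivative y).eval t - ((s + l) ^ 2 - l * (l - 1)) * y.eval t) t := by
  refine (((hasDerivAt_one_sub_sq t).mul ((derivative y).hasDerivAt t)).sub
    (((hasDerivAt_id t).const_mul l).mul (y.hasDerivAt t))).congr_deriv ?_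
  simp only [id]
  linear_combination hy.eval_of_sub_half t

@[fun_prop]
lemma continuous_slope : Continuous (slope l y) := by
  unfold slope; fun_prop

@[fun_prop]
lemma continuous_energy : Continuous (energy l s y) := by
  unfold energy; fun_prop

lemma energy_zero_le (hl : 2 ≤ l) (hα : 0 ≤ l - 1 / 2) (hy : JacobiODE (l - 1 / 2) s y) :
    energy l s y 0 ≤ 4 * (s + l) ^ 2 * wInt (l - 1 / 2) hα (y * y) := by
  have key : ∀ t ∈ Ioo (0 : ℝ) 1, HasDerivAt (fun t : ℝ => (1 - t ^ 2) ^ (l + 1 / 2) *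
      ((1 - t ^ 2) * (derivative y).eval t ^ 2 - (2 * l - 1) * t * y.eval t * (derivative y).eval t
        + ((s + l) ^ 2 - l * (l - 1) - 1 / 2) * y.eval t ^ 2))
      (-((2 * (s + l) ^ 2 - 1 / 2) * t * ((y * y).eval t * (1 - t ^ 2) ^ (l - 1 / 2)))) t := by
    intro t ht
    have h0 := y.hasDerivAt t
    have h1 := (derivative y).hasDerivAt t
    refine (hasDerivAt_weight_mul (l + 1 / 2) (by nlinarith [ht.1, ht.2])
      ((((hasDerivAt_one_sub_sq t).mul (h1.fun_pow 2)).sub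
        ((((hasDerivAt_id t).const_mul (2 * l - 1)).mul h0).mul h1)).add
        ((h0.fun_pow 2).const_mul ((s + l) ^ 2 - l * (l - 1) - 1 / 2)))).congr_deriv ?_
    simp only [Pi.mul_apply, Pi.add_apply, Pi.sub_apply, id, eval_mul,
      show l + 1 / 2 - 1 = l - 1 / 2 by ring]
    push_cast
    linear_combination ((1 - t ^ 2) ^ (l - 1 / 2) * (2 * (1 - t ^ 2) * (derivative y).eval t -
      (2 * l - 1) * t * y.eval t)) * hy.eval_of_sub_half t
  have hw := continuous_weight hα
  have hg : Continuous fun t : ℝ => (y * y).eval t * (1 - t ^ 2) ^ (l - 1 / 2) :=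
    (Polynomial.continuous _).mul hw
  have hI := intervalIntegral.integral_eq_sub_of_hasDerivAt_of_le zero_le_one
    (((continuous_weight (by linarith : 0 ≤ l + 1 / 2)).mul (by fun_prop)).continuousOn) key
    ((by fun_prop : Continuous fun t : ℝ => -((2 * ((s : ℝ) + l) ^ 2 - 1 / 2) * t *
      ((y * y).eval t * (1 - t ^ 2) ^ (l - 1 / 2)))).intervalIntegrable _ _)
  have hl' : l + 1 / 2 ≠ 0 := by positivity
  have hs0 : (0 : ℝ) ≤ s := Nat.cast_nonneg s
  have hgnn : ∀ t ∈ Icc (-1 : ℝ) 1, 0 ≤ (y * y).eval t * (1 - t ^ 2) ^ (l - 1 / 2) := by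
    intro t ht
    rw [eval_mul]
    exact mul_nonneg (mul_self_nonneg _) (Real.rpow_nonneg (by nlinarith [ht.1, ht.2]) _)
  have h1 : ∫ t in (0 : ℝ)..1, ((2 * ((s : ℝ) + l) ^ 2 - 1 / 2) * t *
      ((y * y).eval t * (1 - t ^ 2) ^ (l - 1 / 2))) ≤
      ∫ t in (0 : ℝ)..1, 2 * ((s : ℝ) + l) ^ 2 *
        ((y * y).eval t * (1 - t ^ 2) ^ (l - 1 / 2)) := by
    refine intervalIntegral.integral_mono_on zero_le_one
      (Continuous.intervalIntegrable (by fun_prop) _ _)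
      (Continuous.intervalIntegrable (by fun_prop) _ _) fun t ht => ?_
    refine mul_le_mul_of_nonneg_right ?_ (hgnn t ⟨by linarith [ht.1], ht.2⟩)
    have : 0 ≤ 2 * ((s : ℝ) + l) ^ 2 - 1 / 2 := by nlinarith
    nlinarith [ht.2]
  have h2 : ∫ t in (0 : ℝ)..1, (y * y).eval t * (1 - t ^ 2) ^ (l - 1 / 2) ≤
      wInt (l - 1 / 2) hα (y * y) := by
    rw [wInt_apply]
    refine intervalIntegral.integral_mono_interval (by norm_num) zero_le_one le_rfl ?_
      (hg.intervalIntegrable _ _)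
    refine (MeasureTheory.ae_restrict_iff' measurableSet_Ioc).2 (.of_forall fun t ht => ?_)
    exact hgnn t (Ioc_subset_Icc_self ht)
  rw [intervalIntegral.integral_const_mul] at h1
  rw [intervalIntegral.integral_neg] at hI
  simp only [Pi.mul_apply, one_pow, sub_self, Real.zero_rpow hl', zero_mul, mul_zero, ne_eq,
    OfNat.ofNat_ne_zero, not_false_eq_true, zero_pow, sub_zero, Real.one_rpow, one_mul,
    zero_sub] at hI
  have h3 : energy l s y 0 = (derivative y).eval 0 ^ 2 +
      ((s + l) ^ 2 - l * (l - 1)) * y.eval 0 ^ 2 := by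
    simp [energy, slope]
  have h4 : 0 ≤ ((s + l) ^ 2 - l * (l - 1) - 1) * y.eval 0 ^ 2 :=
    mul_nonneg (by nlinarith) (sq_nonneg _)
  have h5 := mul_le_mul_of_nonneg_left h2 (by positivity : 0 ≤ 2 * ((s : ℝ) + l) ^ 2)
  nlinarith [sq_nonneg ((derivative y).eval 0)]

lemma weight_mul_energy_le (hl : 2 ≤ l) (hy : JacobiODE (l - 1 / 2) s y) {t : ℝ}
    (ht : t ∈ Icc (0 : ℝ) 1) : (1 - t ^ 2) ^ (l - 1) * energy l s y t ≤ energy l s y 0 := by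
  have key : ∀ t ∈ Ioo (0 : ℝ) 1, HasDerivAt (fun t : ℝ => (1 - t ^ 2) ^ (l - 1) *
      energy l s y t) (-((1 - t ^ 2) ^ (l - 1 - 1) * (2 * (l * (l - 1)) * t * y.eval t ^ 2))) t := by
    intro t ht
    refine (hasDerivAt_weight_mul (l - 1) (by nlinarith [ht.1, ht.2])
      (((hasDerivAt_slope hy t).fun_pow 2).add
        ((((hasDerivAt_one_sub_sq t).const_mul (((s : ℝ) + l) ^ 2)).sub_const (l * (l - 1))).mul
          ((y.hasDerivAt t).fun_pow 2)))).congr_deriv ?_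
    simp only [Pi.add_apply, Pi.mul_apply, slope]
    push_cast
    ring
  have hanti : AntitoneOn (fun t : ℝ => (1 - t ^ 2) ^ (l - 1) * energy l s y t) (Icc 0 1) := by
    refine antitoneOn_of_deriv_nonpos (convex_Icc _ _)
      ((continuous_weight (by linarith)).mul (by fun_prop)).continuousOn ?_ ?_
    · rw [interior_Icc]
      exact fun t ht => (key t ht).differentiableAt.differentiableWithinAt
    · rw [interior_Icc]
      intro t ht
      rw [(key t ht).deriv]
      have h2 : 0 ≤ (1 - t ^ 2) ^ (l - 1 - 1) := Real.rpow_nonneg (by nlinarith [ht.1, ht.2]) _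
      have h3 : 0 ≤ l * (l - 1) := by nlinarith
      have h4 := ht.1.le
      have : 0 ≤ (1 - t ^ 2) ^ (l - 1 - 1) * (2 * (l * (l - 1)) * t * y.eval t ^ 2) := by positivity
      linarith
  simpa using hanti (left_mem_Icc.2 zero_le_one) ht ht.1

lemma antitoneOn_weight_mul_sq (hl : 2 ≤ l) (hy : JacobiODE (l - 1 / 2) s y) {τ : ℝ} (hτ : 0 ≤ τ)
    (h : (s + l) ^ 2 * (1 - τ ^ 2) ≤ l * (l - 1)) :
    AntitoneOn (fun t : ℝ => (1 - t ^ 2) ^ l * y.eval t ^ 2) (Icc τ 1) := by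
  have key : ∀ t ∈ Ioo τ 1, HasDerivAt (fun t : ℝ => (1 - t ^ 2) ^ (l - 1 / 2) *
      (y.eval t * slope l y t)) ((1 - t ^ 2) ^ (l - 1 / 2 - 1) *
        (slope l y t ^ 2 + (l * (l - 1) - (s + l) ^ 2 * (1 - t ^ 2)) * y.eval t ^ 2)) t := by
    intro t ht
    refine (hasDerivAt_weight_mul (l - 1 / 2) (by nlinarith [ht.1, ht.2])
      ((y.hasDerivAt t).mul (hasDerivAt_slope hy t))).congr_deriv ?_
    simp only [Pi.mul_apply, slope]
    ring
  have hmono : MonotoneOn (fun t : ℝ => (1 - t ^ 2) ^ (l - 1 / 2) *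
      (y.eval t * slope l y t)) (Icc τ 1) := by
    refine monotoneOn_of_deriv_nonneg (convex_Icc _ _)
      ((continuous_weight (by linarith)).mul (by fun_prop)).continuousOn ?_ ?_
    · rw [interior_Icc]
      exact fun t ht => (key t ht).differentiableAt.differentiableWithinAt
    · rw [interior_Icc]
      intro t ht
      rw [(key t ht).deriv]
      have h2 : 0 ≤ (1 - t ^ 2) ^ (l - 1 / 2 - 1) :=
        Real.rpow_nonneg (by nlinarith [ht.1, ht.2]) _
      have h3 : 0 ≤ l * (l - 1) - (s + l) ^ 2 * (1 - t ^ 2) := by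
        have : ((s : ℝ) + l) ^ 2 * (1 - t ^ 2) ≤ (s + l) ^ 2 * (1 - τ ^ 2) :=
          mul_le_mul_of_nonneg_left (by nlinarith [ht.1]) (sq_nonneg _)
        linarith
      positivity
  have key2 : ∀ t ∈ Ioo τ 1, HasDerivAt (fun t : ℝ => (1 - t ^ 2) ^ l * y.eval t ^ 2)
      ((1 - t ^ 2) ^ (l - 1) * (2 * (y.eval t * slope l y t))) t := by
    intro t ht
    refine (hasDerivAt_weight_mul l (by nlinarith [ht.1, ht.2])
      ((y.hasDerivAt t).fun_pow 2)).congr_deriv ?_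
    simp only [slope]
    push_cast
    ring
  refine antitoneOn_of_deriv_nonpos (convex_Icc _ _)
    ((continuous_weight (by linarith)).mul (by fun_prop)).continuousOn ?_ ?_
  · rw [interior_Icc]
    exact fun t ht => (key2 t ht).differentiableAt.differentiableWithinAt
  · rw [interior_Icc]
    intro t ht
    rw [(key2 t ht).deriv]
    have h1 := hmono (Ioo_subset_Icc_self ht) (right_mem_Icc.2 (ht.1.trans ht.2).le) ht.2.le
    have hl' : l - 1 / 2 ≠ 0 := by linarith
    simp only [one_pow, sub_self, Real.zero_rpow hl', zero_mul] at h1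
    have h0 : 0 < 1 - t ^ 2 := by nlinarith [ht.1, ht.2]
    have h2 := nonpos_of_mul_nonpos_right h1 (Real.rpow_pos_of_pos h0 _)
    exact mul_nonpos_of_nonneg_of_nonpos (Real.rpow_nonneg h0.le _) (by linarith)

end SupBound

section KernelBound

variable {l S : ℝ} {s : ℕ} {y : ℝ[X]}

lemma abs_weight_mul_sub_le (hl : 2 ≤ l) (hy : JacobiODE (l - 1 / 2) s y) (hS : 0 ≤ S)
    (hE : energy l s y 0 ≤ 4 * (s + l) ^ 2 * S ^ 2) {a t : ℝ} (ha : 0 ≤ a) (hat : a ≤ t)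
    (ht : l * (l - 1) ≤ (s + l) ^ 2 * (1 - t ^ 2)) :
    |(1 - t ^ 2) ^ (l / 2) * y.eval t| ≤ |(1 - a ^ 2) ^ (l / 2) * y.eval a| +
      3 * (s + l) ^ 2 * S / l * (t - a) := by
  have hN : 0 < (s : ℝ) + l := by positivity
  have hM : 0 < l * (l - 1) := by nlinarith
  have hpos : ∀ x ∈ Icc a t, 0 < 1 - x ^ 2 ∧ l * (l - 1) ≤ (s + l) ^ 2 * (1 - x ^ 2) := by
    intro x hx
    have : l * (l - 1) ≤ (s + l) ^ 2 * (1 - x ^ 2) := ht.trans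
      (mul_le_mul_of_nonneg_left (by nlinarith [hx.1, hx.2]) (sq_nonneg _))
    exact ⟨pos_of_mul_pos_right (hM.trans_le this) (sq_nonneg _), this⟩
  have hd : ∀ x ∈ Icc a t, HasDerivAt (fun x : ℝ => (1 - x ^ 2) ^ (l / 2) * y.eval x)
      ((1 - x ^ 2) ^ (l / 2 - 1) * slope l y x) x := by
    intro x hx
    refine (hasDerivAt_weight_mul (l / 2) (hpos x hx).1 (y.hasDerivAt x)).congr_deriv ?_
    simp only [slope]
    ring
  have hbd : ∀ x ∈ Icc a t, ‖(1 - x ^ 2) ^ (l / 2 - 1) * slope l y x‖ ≤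
      3 * (s + l) ^ 2 * S / l := by
    intro x hx
    obtain ⟨h0, h1⟩ := hpos x hx
    have h2 := (weight_mul_energy_le hl hy (t := x)
      ⟨ha.trans hx.1, by nlinarith [ha.trans hx.1]⟩).trans hE
    have h3 : 0 < (1 - x ^ 2) ^ (l - 1) := Real.rpow_pos_of_pos h0 _
    have h4 : (1 - x ^ 2) ^ (l - 1) * slope l y x ^ 2 ≤ 4 * (s + l) ^ 2 * S ^ 2 := by
      have : 0 ≤ (1 - x ^ 2) ^ (l - 1) *
          (((s + l) ^ 2 * (1 - x ^ 2) - l * (l - 1)) * y.eval x ^ 2) :=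
        mul_nonneg h3.le (mul_nonneg (by linarith) (sq_nonneg _))
      rw [energy] at h2
      linarith
    have h5 : ((1 - x ^ 2) ^ (l / 2 - 1) * slope l y x) ^ 2 * (1 - x ^ 2) =
        (1 - x ^ 2) ^ (l - 1) * slope l y x ^ 2 := by
      rw [mul_pow, ← Real.rpow_natCast, ← Real.rpow_mul h0.le, mul_right_comm,
        ← Real.rpow_add_one h0.ne']
      congr 2
      push_cast
      ring
    rw [Real.norm_eq_abs]
    refine abs_le_of_sq_le_sq ?_ (by positivity)
    have h6 : ((1 - x ^ 2) ^ (l / 2 - 1) * slope l y x) ^ 2 * (l * (l - 1)) ≤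
        4 * (s + l) ^ 4 * S ^ 2 := by
      calc _ ≤ ((1 - x ^ 2) ^ (l / 2 - 1) * slope l y x) ^ 2 * ((s + l) ^ 2 * (1 - x ^ 2)) :=
            mul_le_mul_of_nonneg_left h1 (sq_nonneg _)
        _ = (s + l) ^ 2 * ((1 - x ^ 2) ^ (l - 1) * slope l y x ^ 2) := by rw [← h5]; ring
        _ ≤ (s + l) ^ 2 * (4 * (s + l) ^ 2 * S ^ 2) :=
            mul_le_mul_of_nonneg_left h4 (sq_nonneg _)
        _ = _ := by ring
    rw [div_pow, le_div_iff₀ (by positivity)]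
    have h7 : 0 ≤ ((1 - x ^ 2) ^ (l / 2 - 1) * slope l y x) ^ 2 * (l * (l - 2)) :=
      mul_nonneg (sq_nonneg _) (by nlinarith)
    have h8 : 0 ≤ (s + l) ^ 4 * S ^ 2 := by positivity
    nlinarith
  have h := (convex_Icc a t).norm_image_sub_le_of_norm_hasDerivWithin_le
    (fun x hx => (hd x hx).hasDerivWithinAt) hbd (left_mem_Icc.2 hat) (right_mem_Icc.2 hat)
  rw [Real.norm_eq_abs, Real.norm_eq_abs, abs_of_nonneg (sub_nonneg.2 hat)] at h
  have := abs_sub_abs_le_abs_sub ((1 - t ^ 2) ^ (l / 2) * y.eval t)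
    ((1 - a ^ 2) ^ (l / 2) * y.eval a)
  linarith

lemma weight_mul_sq_eq {l x v : ℝ} (hx : 0 < x) :
    (x ^ (l / 2) * v) ^ 2 = x ^ l * v ^ 2 := by
  rw [mul_pow, ← Real.rpow_natCast, ← Real.rpow_mul hx.le]
  congr 2
  push_cast
  ring

/-- Bound below the turning point when the degree is large compared to the dimension. -/
lemma abs_weight_mul_le_of_le (hl : 2 ≤ l) (hy : JacobiODE (l - 1 / 2) s y) (hS : 0 ≤ S)
    (hE : energy l s y 0 ≤ 4 * (s + l) ^ 2 * S ^ 2) (hM : 4 * (l * (l - 1)) ≤ (s + l) ^ 2)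
    {t : ℝ} (ht0 : 0 ≤ t) (ht : l * (l - 1) ≤ (s + l) ^ 2 * (1 - t ^ 2)) :
    |(1 - t ^ 2) ^ (l / 2) * y.eval t| ≤ 5 * l * S := by
  have hN : 0 < (s : ℝ) + l := by positivity
  have hM0 : 0 < l * (l - 1) := by nlinarith
  have hlow : ∀ x : ℝ, 0 ≤ x → 2 * (l * (l - 1)) ≤ (s + l) ^ 2 * (1 - x ^ 2) →
      |(1 - x ^ 2) ^ (l / 2) * y.eval x| ≤ 3 * S := by
    intro x hx hx'
    have h0 : 0 < 1 - x ^ 2 :=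
      pos_of_mul_pos_right (lt_of_lt_of_le (by linarith) hx') (sq_nonneg _)
    refine abs_le_of_sq_le_sq ?_ (by positivity)
    rw [weight_mul_sq_eq h0]
    have h2 := (weight_mul_energy_le hl hy (t := x) ⟨hx, by nlinarith⟩).trans hE
    have h3 : 0 < (1 - x ^ 2) ^ (l - 1) := Real.rpow_pos_of_pos h0 _
    have h4 : (1 - x ^ 2) ^ l = (1 - x ^ 2) ^ (l - 1) * (1 - x ^ 2) := by
      rw [← Real.rpow_add_one h0.ne', sub_add_cancel]
    have h5 : (1 - x ^ 2) ^ (l - 1) * ((s + l) ^ 2 * (1 - x ^ 2) / 2 * y.eval x ^ 2) ≤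
        (1 - x ^ 2) ^ (l - 1) * energy l s y x := by
      refine mul_le_mul_of_nonneg_left ?_ h3.le
      have := mul_nonneg (sub_nonneg.2 hx') (sq_nonneg (y.eval x))
      rw [energy]
      nlinarith [sq_nonneg (slope l y x)]
    refine le_of_mul_le_mul_left ?_ (by positivity : 0 < ((s : ℝ) + l) ^ 2)
    rw [h4]
    have h6 : 0 ≤ ((s : ℝ) + l) ^ 2 * S ^ 2 := by positivity
    nlinarith
  by_cases hc : 2 * (l * (l - 1)) ≤ (s + l) ^ 2 * (1 - t ^ 2)
  · refine (hlow t ht0 hc).trans ?_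
    nlinarith
  push Not at hc
  obtain ⟨a, ha0, ha⟩ : ∃ a : ℝ, 0 ≤ a ∧ a ^ 2 = 1 - 2 * (l * (l - 1)) / (s + l) ^ 2 := by
    refine ⟨√(1 - 2 * (l * (l - 1)) / (s + l) ^ 2), Real.sqrt_nonneg _, Real.sq_sqrt ?_⟩
    rw [sub_nonneg, div_le_one (by positivity)]
    linarith
  have ha' : (s + l) ^ 2 * (1 - a ^ 2) = 2 * (l * (l - 1)) := by
    rw [ha]; field_simp; ring
  have hat2 : a ^ 2 ≤ t ^ 2 := by
    have : (s + l) ^ 2 * a ^ 2 ≤ (s + l) ^ 2 * t ^ 2 := by linarith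
    exact le_of_mul_le_mul_left this (by positivity)
  have hat : a ≤ t := by nlinarith
  have ha2 : 1 / 2 ≤ a ^ 2 := by
    have : (s + l) ^ 2 * (1 / 2) ≤ (s + l) ^ 2 * a ^ 2 := by linarith
    exact le_of_mul_le_mul_left this (by positivity)
  have h1 := abs_weight_mul_sub_le hl hy hS hE ha0 hat ht
  have h2 := hlow a ha0 ha'.ge
  have h3 : (s + l) ^ 2 * (t - a) ≤ l * (l - 1) := by
    have h4 : t - a ≤ t ^ 2 - a ^ 2 := by
      have : 1 / 2 ≤ a := by nlinarith
      nlinarith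
    have h5 := mul_le_mul_of_nonneg_left h4 (sq_nonneg ((s : ℝ) + l))
    linarith
  have h4 : 3 * (s + l) ^ 2 * S / l * (t - a) ≤ 3 * (l - 1) * S := by
    rw [div_mul_eq_mul_div, div_le_iff₀ (by linarith)]
    have := mul_le_mul_of_nonneg_left h3 hS
    nlinarith
  nlinarith

/-- Bound below the turning point when the degree is small compared to the dimension. -/
lemma abs_weight_mul_le_of_lt {r : ℝ} (hl : 2 ≤ l) (hr : 0 ≤ r) (hrl : r ^ 2 = l) (hs : 2 ≤ s)
    (hy : JacobiODE (l - 1 / 2) s y) (hS : 0 ≤ S)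
    (hE : energy l s y 0 ≤ 4 * (s + l) ^ 2 * S ^ 2) (hM : (s + l) ^ 2 < 4 * (l * (l - 1)))
    {t : ℝ} (ht0 : 0 ≤ t) (ht : l * (l - 1) ≤ (s + l) ^ 2 * (1 - t ^ 2)) :
    |(1 - t ^ 2) ^ (l / 2) * y.eval t| ≤ 20 * s * r * S := by
  have hs' : (2 : ℝ) ≤ s := by exact_mod_cast hs
  have hN : 0 < (s : ℝ) + l := by positivity
  have hNl : (s : ℝ) + l ≤ 2 * l := by nlinarith
  have h1 := abs_weight_mul_sub_le hl hy hS hE le_rfl ht0 ht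
  have h2 : |y.eval 0| ≤ 2 * r * S := by
    refine abs_le_of_sq_le_sq ?_ (by positivity)
    have h3 : energy l s y 0 = (derivative y).eval 0 ^ 2 +
        ((s + l) ^ 2 - l * (l - 1)) * y.eval 0 ^ 2 := by
      simp [energy, slope]
    have h4 : 4 * l * y.eval 0 ^ 2 ≤ ((s + l) ^ 2 - l * (l - 1)) * y.eval 0 ^ 2 :=
      mul_le_mul_of_nonneg_right (by nlinarith) (sq_nonneg _)
    have h5 : ((s : ℝ) + l) ^ 2 * S ^ 2 ≤ (2 * l) ^ 2 * S ^ 2 :=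
      mul_le_mul_of_nonneg_right (by nlinarith) (sq_nonneg _)
    have h6 : l * y.eval 0 ^ 2 ≤ l * (4 * l * S ^ 2) := by
      nlinarith [sq_nonneg ((derivative y).eval 0)]
    have h7 := le_of_mul_le_mul_left h6 (by linarith)
    calc _ ≤ _ := h7
      _ = _ := by rw [← hrl]; ring
  have h3 : (s + l) * t ≤ 2 * s * r := by
    refine le_of_sq_le_sq ?_ (by positivity)
    have : ((s + l) * t) ^ 2 ≤ (s + l) ^ 2 - l * (l - 1) := by linarith
    refine this.trans ?_
    rw [mul_pow, hrl]
    nlinarith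
  have h4 : 3 * (s + l) ^ 2 * S / l * (t - 0) ≤ 12 * s * r * S := by
    rw [div_mul_eq_mul_div, div_le_iff₀ (by linarith), sub_zero]
    calc 3 * (s + l) ^ 2 * S * t = 3 * S * ((s + l) * ((s + l) * t)) := by ring
      _ ≤ 3 * S * (2 * l * (2 * s * r)) := by gcongr
      _ = _ := by ring
  have h5 : 2 * r * S ≤ s * r * S := by gcongr
  simp only [ne_eq, OfNat.ofNat_ne_zero, not_false_eq_true, zero_pow, sub_zero, Real.one_rpow,
    one_mul] at h1 h4
  have h6 : 0 ≤ s * r * S := by positivity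
  linarith

lemma abs_weight_mul_le {r : ℝ} (hl : 2 ≤ l) (hr : 0 ≤ r) (hrl : r ^ 2 = l) (hs : 2 ≤ s)
    (hy : JacobiODE (l - 1 / 2) s y) (hS : 0 ≤ S)
    (hE : energy l s y 0 ≤ 4 * (s + l) ^ 2 * S ^ 2) {t : ℝ} (ht0 : 0 ≤ t) (ht1 : t < 1) :
    |(1 - t ^ 2) ^ (l / 2) * y.eval t| * (s + l) ≤ 40 * s * r ^ 3 * S := by
  have hs' : (2 : ℝ) ≤ s := by exact_mod_cast hs
  have hN : 0 < (s : ℝ) + l := by positivity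
  have hr1 : 1 ≤ r := by nlinarith
  have hM0 : 0 < l * (l - 1) := by nlinarith
  have hbelow : ∀ x : ℝ, 0 ≤ x → l * (l - 1) ≤ (s + l) ^ 2 * (1 - x ^ 2) →
      |(1 - x ^ 2) ^ (l / 2) * y.eval x| * (s + l) ≤ 40 * s * r ^ 3 * S := by
    intro x hx hx'
    rcases le_or_gt (4 * (l * (l - 1))) ((s + l) ^ 2) with hM | hM
    · have h1 := abs_weight_mul_le_of_le hl hy hS hE hM hx hx'
      have h2 : l ≤ 3 / 4 * (s + l) := by nlinarith
      have h3 : (s : ℝ) + l ≤ 4 * s := by linarith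
      calc _ ≤ 5 * l * S * (4 * s) := by gcongr
        _ = 20 * s * r ^ 2 * S * 1 := by rw [hrl]; ring
        _ ≤ 20 * s * r ^ 2 * S * (2 * r) := by gcongr; linarith
        _ = _ := by ring
    · have h1 := abs_weight_mul_le_of_lt hl hr hrl hs hy hS hE hM hx hx'
      have h2 : (s : ℝ) + l ≤ 2 * l := by nlinarith
      calc _ ≤ 20 * s * r * S * (2 * l) := by gcongr
        _ = _ := by rw [← hrl]; ring
  rcases le_or_gt (l * (l - 1)) ((s + l) ^ 2 * (1 - t ^ 2)) with h | h
  · exact hbelow t ht0 h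
  obtain ⟨τ, hτ0, hτ⟩ : ∃ τ : ℝ, 0 ≤ τ ∧ τ ^ 2 = 1 - l * (l - 1) / (s + l) ^ 2 := by
    refine ⟨√(1 - l * (l - 1) / (s + l) ^ 2), Real.sqrt_nonneg _, Real.sq_sqrt ?_⟩
    rw [sub_nonneg, div_le_one (by positivity)]
    nlinarith
  have hτ' : (s + l) ^ 2 * (1 - τ ^ 2) = l * (l - 1) := by
    rw [hτ]; field_simp; ring
  have hτt2 : τ ^ 2 ≤ t ^ 2 := by
    have : (s + l) ^ 2 * τ ^ 2 ≤ (s + l) ^ 2 * t ^ 2 := by linarith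
    exact le_of_mul_le_mul_left this (by positivity)
  have hτt : τ ≤ t := by nlinarith
  have h1 := antitoneOn_weight_mul_sq hl hy hτ0 hτ'.le (left_mem_Icc.2 (hτt.trans ht1.le))
    ⟨hτt, ht1.le⟩ hτt
  have h2 : |(1 - t ^ 2) ^ (l / 2) * y.eval t| ≤ |(1 - τ ^ 2) ^ (l / 2) * y.eval τ| := by
    rw [← sq_le_sq, weight_mul_sq_eq (by nlinarith), weight_mul_sq_eq (by nlinarith)]
    exact h1
  exact (mul_le_mul_of_nonneg_right h2 hN.le).trans (hbelow τ hτ0 hτ'.ge)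

lemma abs_weight_mul_slope_le {g G t : ℝ} (hl : 2 ≤ l) (hy : JacobiODE (l - 1 / 2) s y)
    (hS : 0 ≤ S) (hE : energy l s y 0 ≤ 4 * (s + l) ^ 2 * S ^ 2) (ht : t ∈ Ico 0 1)
    (hG0 : 0 ≤ G) (hgG : g ≤ G ^ 2) (hgx : 1 ≤ g * (1 - t ^ 2)) :
    |(1 - t ^ 2) ^ (l / 2) * slope l y t| ≤ (1 - t ^ 2) *
      (2 * (s + l) * S * G + l * g * |(1 - t ^ 2) ^ (l / 2) * y.eval t|) := by
  have hx0 : 0 < 1 - t ^ 2 := by nlinarith [ht.1, ht.2]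
  have hN : 0 < (s : ℝ) + l := by positivity
  have hg0 : 0 < g := pos_of_mul_pos_left (zero_lt_one.trans_le hgx) hx0.le
  have hE' := (weight_mul_energy_le hl hy ⟨ht.1, ht.2.le⟩).trans hE
  have h1 : ((1 - t ^ 2) ^ (l / 2) * slope l y t) ^ 2 ≤ (1 - t ^ 2) * (2 * (s + l) * S) ^ 2 +
      (l * |(1 - t ^ 2) ^ (l / 2) * y.eval t|) ^ 2 := by
    rw [mul_pow l, sq_abs, weight_mul_sq_eq hx0, weight_mul_sq_eq hx0]
    rw [energy] at hE'
    generalize 1 - t ^ 2 = x at *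
    have h2 : x ^ l = x ^ (l - 1) * x := by
      rw [← Real.rpow_add_one hx0.ne', sub_add_cancel]
    have h3 : 0 < x ^ (l - 1) := Real.rpow_pos_of_pos hx0 _
    have h4 := mul_le_mul_of_nonneg_left hE' hx0.le
    rw [h2]
    have h5 : 0 ≤ x ^ (l - 1) * x * (((s + l) ^ 2 * x + l) * y.eval t ^ 2) := by positivity
    linarith
  have hu0 := abs_nonneg ((1 - t ^ 2) ^ (l / 2) * y.eval t)
  generalize |(1 - t ^ 2) ^ (l / 2) * y.eval t| = u at *
  have hc : 0 ≤ 2 * (s + l) * S := by positivity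
  refine abs_le_of_sq_le_sq (h1.trans ?_) (by positivity)
  clear h1 hE' hE
  generalize 1 - t ^ 2 = x at *
  generalize 2 * (s + l) * S = c at *
  have h2 : x ≤ (x * G) ^ 2 := by
    have : x * 1 ≤ x * (G ^ 2 * x) := by gcongr; exact hgx.trans (by gcongr)
    linarith
  have h3 : l * u ≤ x * (l * g * u) := by
    have : l * u * 1 ≤ l * u * (g * x) := by gcongr
    linarith
  calc x * c ^ 2 + (l * u) ^ 2 ≤ (x * G) ^ 2 * c ^ 2 + (x * (l * g * u)) ^ 2 := by gcongr
    _ ≤ _ := by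
      have : 0 ≤ x * G * c * (x * (l * g * u)) := by positivity
      linarith

/-- The arithmetic behind `X_mul_derivative_sub_le`. -/
lemma kernel_bound_aux {r g G u N : ℝ} {s : ℝ} (hs : 2 ≤ s) (hl : 2 ≤ l) (hr : 1 ≤ r)
    (hrl : r ^ 2 = l) (hS : 0 ≤ S) (hN : N = s + l) (hG : G = 4 * N / l) (hgG : g ≤ G ^ 2)
    (hu0 : 0 ≤ u) (hu : u * N ≤ 40 * s * r ^ 3 * S) :
    2 * N * S * G + l * g * u + (s + (2 * l - 1) * g) * u ≤ 2000 * s * N * r * S := by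
  have hN0 : 0 < N := by linarith
  have h1 : 2 * N * S * G ≤ 8 * s * N * S := by
    have : G ≤ 4 * s := by
      rw [hG, div_le_iff₀ (by linarith)]
      nlinarith
    calc _ ≤ 2 * N * S * (4 * s) := by gcongr
      _ = _ := by ring
  have h2 : l * g * u + (s + (2 * l - 1) * g) * u ≤ 49 * (N / l) * (u * N) := by
    have h3 : (3 * l - 1) * g ≤ 48 * (N ^ 2 / l) := by
      calc (3 * l - 1) * g ≤ (3 * l - 1) * G ^ 2 := by gcongr; linarith
        _ ≤ 3 * l * G ^ 2 := by gcongr; linarith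
        _ = _ := by rw [hG]; field_simp; ring
    have h4 : s ≤ N ^ 2 / l := by
      rw [le_div_iff₀ (by linarith)]; nlinarith
    calc _ = (s + (3 * l - 1) * g) * u := by ring
      _ ≤ 49 * (N ^ 2 / l) * u := by gcongr; linarith
      _ = _ := by ring
  have h3 : 49 * (N / l) * (u * N) ≤ 1960 * s * N * r * S := by
    calc _ ≤ 49 * (N / l) * (40 * s * r ^ 3 * S) := by gcongr
      _ = 1960 * s * N * r * S * (r ^ 2 / l) := by ring
      _ = _ := by rw [hrl, div_self (by linarith), mul_one]
  have h4 : 8 * s * N * S * 1 ≤ 8 * s * N * S * r := by gcongr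
  have h5 : 0 ≤ s * N * r * S := by positivity
  linarith

lemma X_mul_derivative_sub_le {r ρ : ℝ} (hl : 2 ≤ l) (hr : 0 ≤ r) (hrl : r ^ 2 = l)
    (hs : 2 ≤ s) (hy : JacobiODE (l - 1 / 2) s y) (hS : 0 ≤ S)
    (hE : energy l s y 0 ≤ 4 * (s + l) ^ 2 * S ^ 2) (hρ1 : ρ < 1)
    (hρ : l ^ 2 ≤ 16 * (s + l) ^ 2 * (1 - ρ ^ 2)) {t : ℝ} (ht : t ∈ Icc 0 ρ) :
    t * (derivative y).eval t - (s + (2 * l - 1) / (1 - ρ ^ 2)) * y.eval t ≤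
      2000 * s * (s + l) * r * S / (1 - ρ ^ 2) ^ (l / 2) := by
  have hs' : (2 : ℝ) ≤ s := by exact_mod_cast hs
  have hN : 0 < (s : ℝ) + l := by positivity
  have ht1 : t < 1 := ht.2.trans_lt hρ1
  have hx0 : 0 < 1 - t ^ 2 := by nlinarith [ht.1]
  have hρ0 : 0 < 1 - ρ ^ 2 := by nlinarith [ht.1, ht.2]
  have hxρ : 1 - ρ ^ 2 ≤ 1 - t ^ 2 := by nlinarith [ht.1, ht.2]
  have hu := abs_weight_mul_le hl hr hrl hs hy hS hE ht.1 ht1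
  have hWρ : (1 - ρ ^ 2) ^ (l / 2) ≤ (1 - t ^ 2) ^ (l / 2) :=
    Real.rpow_le_rpow hρ0.le hxρ (by linarith)
  have hWρ0 : 0 < (1 - ρ ^ 2) ^ (l / 2) := Real.rpow_pos_of_pos hρ0 _
  obtain ⟨g, hg⟩ : ∃ g, g = 1 / (1 - ρ ^ 2) := ⟨_, rfl⟩
  obtain ⟨G, hG⟩ : ∃ G, G = 4 * (s + l) / l := ⟨_, rfl⟩
  have hG0 : 0 ≤ G := by rw [hG]; positivity
  have hgG : g ≤ G ^ 2 := by
    rw [hg, hG, div_pow, div_le_div_iff₀ hρ0 (by positivity)]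
    linarith
  have hgx : 1 ≤ g * (1 - t ^ 2) := by
    rw [hg, one_div_mul_eq_div, le_div_iff₀ hρ0]; linarith
  have hWA := abs_weight_mul_slope_le hl hy hS hE ⟨ht.1, ht1⟩ hG0 hgG hgx
  have hsum := kernel_bound_aux hs' hl (by nlinarith) hrl hS rfl hG hgG (abs_nonneg _) hu
  rw [div_eq_mul_one_div (2 * l - 1), ← hg]
  have hg0 : 0 < g := by rw [hg]; positivity
  clear hg hu hE hG
  rw [slope] at hWA
  generalize hx : 1 - t ^ 2 = x at *
  generalize x ^ (l / 2) = W at *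
  have hW0 : 0 < W := hWρ0.trans_le hWρ
  obtain ⟨B, hB⟩ : ∃ B, B = s + (2 * l - 1) * g := ⟨_, rfl⟩
  rw [← hB] at hsum ⊢
  have hcoef : |(l * t ^ 2 - B * x) * (W * y.eval t)| ≤ x * (B * |W * y.eval t|) := by
    rw [abs_mul, ← mul_assoc]
    refine mul_le_mul_of_nonneg_right ?_ (abs_nonneg _)
    have hB0 : l * g ≤ B := by rw [hB]; nlinarith
    have h1 : l * t ^ 2 ≤ B * x := by
      have h2 : l * g * x ≤ B * x := mul_le_mul_of_nonneg_right hB0 hx0.le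
      nlinarith
    rw [abs_le]
    constructor <;> nlinarith [sq_nonneg t]
  have hK : x * (W * (t * (derivative y).eval t - B * y.eval t)) ≤
      x * (2 * (s + l) * S * G + l * g * |W * y.eval t| + B * |W * y.eval t|) := by
    have h2 : t * (W * (x * (derivative y).eval t - l * t * y.eval t)) ≤
        |W * (x * (derivative y).eval t - l * t * y.eval t)| := by
      refine (le_abs_self _).trans ?_
      rw [abs_mul, abs_of_nonneg ht.1]
      exact mul_le_of_le_one_left (abs_nonneg _) ht1.le
    have := le_abs_self ((l * t ^ 2 - B * x) * (W * y.eval t))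
    linarith
  have hK' := le_of_mul_le_mul_left hK hx0
  calc t * (derivative y).eval t - B * y.eval t
      ≤ 2000 * s * (s + l) * r * S / W := by
        rw [le_div_iff₀ hW0]; linarith
    _ ≤ _ := by gcongr

end KernelBound

section Duality

variable {s : ℕ} {B : ℝ} {P : ℕ → ℝ[X]}

lemma wInt_one_le {l r : ℝ} (hα : 0 ≤ l - 1 / 2) (hl : 2 ≤ l) (hr : 0 < r) (hrl : r ^ 2 = l) :
    wInt (l - 1 / 2) hα 1 ≤ 3 / r := by
  have hc : 0 < l - 1 / 2 := by linarith
  have h1 : wInt (l - 1 / 2) hα 1 ≤ ∫ t in (-1 : ℝ)..1, Real.exp (-(l - 1 / 2) * t ^ 2) := by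
    rw [wInt_apply]
    refine intervalIntegral.integral_mono_on (by norm_num)
      (((Polynomial.continuous _).mul (continuous_weight hα)).intervalIntegrable _ _)
      (Continuous.intervalIntegrable (by fun_prop) _ _) fun t ht => ?_
    rw [eval_one, one_mul, neg_mul, mul_comm, ← neg_mul, Real.exp_mul]
    exact Real.rpow_le_rpow (by nlinarith [ht.1, ht.2]) (Real.one_sub_le_exp_neg _) hα
  have h2 : ∫ t in (-1 : ℝ)..1, Real.exp (-(l - 1 / 2) * t ^ 2) ≤ √(Real.pi / (l - 1 / 2)) := by
    rw [← integral_gaussian, intervalIntegral.integral_of_le (by norm_num)]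
    exact MeasureTheory.setIntegral_le_integral (integrable_exp_neg_mul_sq hc)
      (.of_forall fun _ => (Real.exp_pos _).le)
  refine h1.trans (h2.trans (Real.sqrt_le_iff.2 ⟨by positivity, ?_⟩))
  rw [div_pow, hrl, div_le_div_iff₀ hc (by linarith)]
  nlinarith [Real.pi_lt_four]

lemma comp_neg_X_mul_derivative_sub {y : ℝ[X]} (hy : y.comp (-X) = y) :
    (X * derivative y - C B * y).comp (-X) = X * derivative y - C B * y := by
  have h1 : (derivative y).comp (-X) = -derivative y := by
    have := congrArg derivative hy
    rw [derivative_comp] at this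
    simp only [derivative_neg, derivative_X] at this
    linear_combination -this
  simp only [sub_comp, mul_comp, X_comp, C_comp, h1, hy]
  ring

lemma wInt_X_mul_derivative_mul_eval_le (hP : ∀ s, IsJacobi α s (P s)) (hs : 1 ≤ s)
    (hev : Even s) (hB : (s : ℝ) ≤ B) {j : ℕ} {c : ℝ} (hc : s ≤ j → c ≤ 0) :
    wInt α hα (X * derivative (P s)) * (c * ((P j).eval 1 + (P j).eval (-1))) ≤
      2 * (c * wInt α hα (P j * (X * derivative (P s) - C B * P s))) := by
  have hev' : (P s).comp (-X) = P s := by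
    rw [comp_neg_eq hα (hP s), hev.neg_one_pow, C_1, one_mul]
  have hpos : 0 < wInt α hα (P s * P s) := wInt_mul_self_pos (ne_zero (hP s))
  have hκ : 0 < wInt α hα (X * derivative (P s)) := by
    have h1 := wInt_X_mul_derivative (hα := hα) hs hev (hP s)
    have h2 : 0 < (2 * s + 2 * α + 1) * wInt α hα (P s * P s) := by positivity
    rw [← h1] at h2
    exact pos_of_mul_pos_left h2 (eval_one_pos hα (hP s)).le
  have hj1 := eval_one_pos hα (hP j)
  rcases Nat.even_or_odd j with hj | hj
  · have hjn : (P j).eval (-1) = (P j).eval 1 := by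
      rw [eval_neg_eq hα (hP j), hj.neg_one_pow, one_mul]
    rw [hjn]
    rcases lt_trichotomy j s with h | rfl | h
    · have hj' : (P j).comp (-X) = P j := by
        rw [comp_neg_eq hα (hP j), hj.neg_one_pow, C_1, one_mul]
      have h1 := wInt_mul_X_mul_derivative_of_lt (hα := hα) (hP s) hj'
        (by rw [natDegree_eq (hP j)]; exact h)
      have h2 := wInt_mul_eq_zero (hα := hα) (hP s) (g := P j)
        (by rw [(hP j).1]; exact_mod_cast h)
      have h3 : P j * (X * derivative (P s) - C B * P s) =
          P j * (X * derivative (P s)) - C B * (P s * P j) := by ring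
      rw [h3, map_sub, wInt_C_mul, h1, h2]
      linarith
    · have h1 := wInt_self_mul_X_mul_derivative (hα := hα) (hP j)
      have h3 : P j * (X * derivative (P j) - C B * P j) =
          P j * (X * derivative (P j)) - C B * (P j * P j) := by ring
      rw [h3, map_sub, wInt_C_mul, h1]
      have hc' := hc le_rfl
      have h4 : 0 ≤ c * (j * wInt α hα (P j * P j) - B * wInt α hα (P j * P j)) :=
        mul_nonneg_of_nonpos_of_nonpos hc' (by nlinarith)
      have h5 : wInt α hα (X * derivative (P j)) * (c * ((P j).eval 1 + (P j).eval 1)) ≤ 0 :=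
        mul_nonpos_of_nonneg_of_nonpos hκ.le (mul_nonpos_of_nonpos_of_nonneg hc' (by linarith))
      linarith
    · have h1 : wInt α hα (P j * (X * derivative (P s) - C B * P s)) = 0 := by
        refine wInt_mul_eq_zero (hP j) (lt_of_le_of_lt ?_ (Nat.cast_lt.2 h))
        rw [← natDegree_le_iff_degree_le]
        refine (natDegree_sub_le _ _).trans (max_le ?_ ?_)
        · refine natDegree_le_iff_coeff_eq_zero.2 fun m hm => ?_
          rcases m with _ | m
          · simp
          · rw [coeff_X_mul, coeff_derivative, coeff_eq_zero_of_natDegree_lt, zero_mul]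
            rw [natDegree_eq (hP s)]
            omega
        · exact (natDegree_C_mul_le _ _).trans (natDegree_eq (hP s)).le
      rw [h1, mul_zero, mul_zero]
      exact mul_nonpos_of_nonneg_of_nonpos hκ.le
        (mul_nonpos_of_nonpos_of_nonneg (hc h.le) (by linarith))
  · have h1 : wInt α hα (P j * (X * derivative (P s) - C B * P s)) = 0 := by
      refine wInt_eq_zero_of_comp_neg ?_
      rw [mul_comp, comp_neg_X_mul_derivative_sub hev', comp_neg_eq hα (hP j), hj.neg_one_pow]
      simp
    have hjn : (P j).eval (-1) = -(P j).eval 1 := by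
      rw [eval_neg_eq hα (hP j), hj.neg_one_pow, neg_one_mul]
    rw [h1, hjn]
    simp

/-- Weak duality for the linear program, with test polynomial `t y' - B y`. -/
lemma one_div_le_of_kernel_le (hP : ∀ s, IsJacobi α s (P s)) (hs : 1 ≤ s) (hev : Even s)
    (hB : (s : ℝ) ≤ B) {D : ℝ}
    (hD : ∀ t ∈ Icc (-1 : ℝ) 1, (X * derivative (P s) - C B * P s).eval t ≤ D)
    {m : ℕ} {a : ℕ → ℝ} {F : ℝ[X]} (hF : F = ∑ j ∈ Finset.range (m + 1), C (a j) * P j)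
    (hF0 : ∀ t ∈ Icc (-1 : ℝ) 1, 0 ≤ F.eval t) (hF1 : F.eval 1 = 1) (ha0 : 0 < a 0)
    (ha : ∀ j, s ≤ j → a j ≤ 0) :
    (s + α + 1 / 2) * wInt α hα (P s * P s) * (1 / a 0) ≤
      D * wInt α hα 1 * (P s).eval 1 := by
  have hpos : 0 < wInt α hα (P s * P s) := wInt_mul_self_pos (ne_zero (hP s))
  have hy1 := eval_one_pos hα (hP s)
  have hκ := wInt_X_mul_derivative (hα := hα) hs hev (hP s)
  have hκ0 : 0 < wInt α hα (X * derivative (P s)) := by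
    have h2 : 0 < (2 * s + 2 * α + 1) * wInt α hα (P s * P s) := by positivity
    rw [← hκ] at h2
    exact pos_of_mul_pos_left h2 hy1.le
  have h1 : wInt α hα (X * derivative (P s)) * (F.eval 1 + F.eval (-1)) ≤
      2 * wInt α hα (F * (X * derivative (P s) - C B * P s)) := by
    have e1 : F.eval 1 + F.eval (-1) =
        ∑ j ∈ Finset.range (m + 1), a j * ((P j).eval 1 + (P j).eval (-1)) := by
      simp [hF, eval_finsetSum, Finset.sum_add_distrib, mul_add]
    have e2 : wInt α hα (F * (X * derivative (P s) - C B * P s)) = ∑ j ∈ Finset.range (m + 1),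
        a j * wInt α hα (P j * (X * derivative (P s) - C B * P s)) := by
      rw [hF, Finset.sum_mul, map_sum]
      exact Finset.sum_congr rfl fun j _ => by rw [mul_assoc, wInt_C_mul]
    rw [e1, e2, Finset.mul_sum, Finset.mul_sum]
    exact Finset.sum_le_sum fun j _ => wInt_X_mul_derivative_mul_eval_le hP hs hev hB (ha j)
  have h2 : wInt α hα (F * (X * derivative (P s) - C B * P s)) ≤ D * wInt α hα F := by
    rw [← wInt_C_mul]
    refine wInt_mono fun t ht => ?_
    rw [eval_mul, eval_mul, eval_C, mul_comm]
    exact mul_le_mul_of_nonneg_right (hD t ht) (hF0 t ht)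
  have h3 : wInt α hα F = a 0 * wInt α hα 1 := by
    rw [hF, map_sum, Finset.sum_range_succ', eq_one (hP 0) hα, wInt_C_mul, Finset.sum_eq_zero,
      zero_add]
    intro j _
    have := wInt_mul_eq_zero (hα := hα) (hP (j + 1)) (g := 1)
      (by rw [degree_one]; exact_mod_cast Nat.succ_pos j)
    rw [mul_one] at this
    rw [wInt_C_mul, this, mul_zero]
  have h4 := hF0 (-1) (by simp)
  rw [hF1] at h1
  have h5 : wInt α hα (X * derivative (P s)) ≤ 2 * (D * (a 0 * wInt α hα 1)) := by
    rw [← h3]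
    nlinarith
  have h6 := mul_le_mul_of_nonneg_right h5 hy1.le
  rw [hκ] at h6
  rw [mul_one_div, div_le_iff₀ ha0]
  linarith

end Duality

section Main

variable {l ρ : ℝ} {s : ℕ} {P : ℕ → ℝ[X]} {z : ℝ[X]}

lemma pos_of_isGreatest_root (hb : 0 < l - 3 / 2) (hev : Even s) (hz : IsJacobi (l - 3 / 2) s z)
    (hρ : IsGreatest {t : ℝ | z.eval t = 0} ρ) : 0 < ρ := by
  have h0 : 0 ≤ ρ := by
    have : -ρ ∈ {t : ℝ | z.eval t = 0} := by
      rw [mem_ofPred_eq, eval_neg_eq hb.le hz, hρ.1, mul_zero]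
    linarith [hρ.2 this]
  refine h0.lt_of_ne ?_
  rintro rfl
  have h1 := derivative_eval_largestRoot_pos hb (jacobiODE hb.le hz) (eval_one_pos hb.le hz)
    hρ le_rfl
  have h2 := congrArg (fun p : ℝ[X] => (derivative p).eval 0) (comp_neg_eq hb.le hz)
  simp [derivative_comp, hev.neg_one_pow] at h2
  linarith

lemma kernel_le (hl : 2 ≤ l) (hα : 0 ≤ l - 1 / 2) (hs : 2 ≤ s) (hev : Even s) {y : ℝ[X]}
    (hy : IsJacobi (l - 1 / 2) s y) (hz : IsJacobi (l - 3 / 2) s z)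
    (hρ : IsGreatest {t : ℝ | z.eval t = 0} ρ) {t : ℝ} (ht : t ∈ Icc (-1) 1) :
    (X * derivative y - C (s + (2 * l - 1) / (1 - ρ ^ 2)) * y).eval t ≤
      2000 * s * (s + l) * √l * √(wInt (l - 1 / 2) hα (y * y)) / (1 - ρ ^ 2) ^ (l / 2) := by
  have hb : 0 < l - 3 / 2 := by linarith
  have hzO := jacobiODE hb.le hz
  have hz1 := eval_one_pos hb.le hz
  have hρ0 := pos_of_isGreatest_root hb hev hz hρ
  have hρ1 := largestRoot_lt_one hb hzO hz1 hρ
  have hyO := jacobiODE hα hy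
  have hρ2 : 0 < 1 - ρ ^ 2 := by nlinarith
  have hys : y.comp (-X) = y := by
    rw [comp_neg_eq hα hy, hev.neg_one_pow, C_1, one_mul]
  wlog ht0 : 0 ≤ t generalizing t
  · have h1 := this (t := -t) ⟨by linarith [ht.2], by linarith [ht.1]⟩ (by linarith)
    have h2 := congrArg (Polynomial.eval t)
      (comp_neg_X_mul_derivative_sub (B := s + (2 * l - 1) / (1 - ρ ^ 2)) hys)
    rw [eval_comp, eval_neg, eval_X] at h2
    rwa [← h2]
  simp only [eval_sub, eval_mul, eval_X, eval_C]
  rcases le_total t ρ with h | h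
  · have hS : √(wInt (l - 1 / 2) hα (y * y)) ^ 2 = wInt (l - 1 / 2) hα (y * y) :=
      Real.sq_sqrt (wInt_mul_self_pos (ne_zero hy)).le
    refine X_mul_derivative_sub_le hl (Real.sqrt_nonneg _) (Real.sq_sqrt (by linarith)) hs hyO
      (Real.sqrt_nonneg _) ?_ hρ1 ?_ ⟨ht0, h⟩
    · rw [hS]
      exact energy_zero_le hl hα hyO
    · have h1 := largestRoot_sq_le hb hzO hz1 hρ hρ0.le
      have hs0 : (0 : ℝ) ≤ s := Nat.cast_nonneg s
      have h2 : (l - 3 / 2) ^ 2 ≤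
          ((l - 3 / 2) ^ 2 + s * (s + 2 * (l - 3 / 2) + 1)) * (1 - ρ ^ 2) := by linarith
      have h3 : (l - 3 / 2) ^ 2 + s * (s + 2 * (l - 3 / 2) + 1) ≤ (s + l) ^ 2 := by nlinarith
      have h4 := mul_le_mul_of_nonneg_right h3 hρ2.le
      nlinarith
  · have hbl : l - 3 / 2 + 1 = l - 1 / 2 := by ring
    obtain ⟨h1, h2⟩ := eval_pos_and_X_mul_derivative_eval hb hzO hz1 hρ hρ0 (y := y)
      (by rw [hbl]; exact hyO) (eval_one_pos hα hy) (natDegree_eq hy) (natDegree_eq hz)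
    rw [show 2 * (l - 3 / 2) + 2 = 2 * l - 1 by ring] at h2
    have h3 := X_mul_derivative_le hα (by omega) hyO hρ0.le h1 h2 ⟨h, ht.2⟩
    have h4 : 0 ≤ 2000 * s * (s + l) * √l * √(wInt (l - 1 / 2) hα (y * y)) /
        (1 - ρ ^ 2) ^ (l / 2) := by positivity
    linarith

lemma one_div_coeff_zero_le (hl : 2 ≤ l) (hα : 0 ≤ l - 1 / 2) (hs : 2 ≤ s) (hev : Even s)
    (hP : ∀ j, IsJacobi (l - 1 / 2) j (P j)) (hz : IsJacobi (l - 3 / 2) s z)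
    (hρ : IsGreatest {t : ℝ | z.eval t = 0} ρ)
    {m : ℕ} {a : ℕ → ℝ} {F : ℝ[X]} (hF : F = ∑ j ∈ Finset.range (m + 1), C (a j) * P j)
    (hF0 : ∀ t ∈ Icc (-1 : ℝ) 1, 0 ≤ F.eval t) (hF1 : F.eval 1 = 1) (ha0 : 0 < a 0)
    (ha : ∀ j, s ≤ j → a j ≤ 0) :
    1 / a 0 ≤ 6000 * s * (1 / (1 - ρ ^ 2)) ^ (l / 2) *
      ((P s).eval 1 / √(wInt (l - 1 / 2) hα (P s * P s))) := by
  have hb : 0 < l - 3 / 2 := by linarith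
  have hρ0 := pos_of_isGreatest_root hb hev hz hρ
  have hρ1 := largestRoot_lt_one hb (jacobiODE hb.le hz) (eval_one_pos hb.le hz) hρ
  have hρ2 : 0 < 1 - ρ ^ 2 := by nlinarith
  have hB : (s : ℝ) ≤ s + (2 * l - 1) / (1 - ρ ^ 2) :=
    le_add_of_nonneg_right (div_nonneg (by linarith) hρ2.le)
  have h1 := one_div_le_of_kernel_le (hα := hα) hP (by omega) hev hB
    (fun t ht => kernel_le hl hα hs hev (hP s) hz hρ ht) hF hF0 hF1 ha0 ha
  have hS0 : 0 < √(wInt (l - 1 / 2) hα (P s * P s)) :=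
    Real.sqrt_pos.2 (wInt_mul_self_pos (ne_zero (hP s)))
  have hS : √(wInt (l - 1 / 2) hα (P s * P s)) ^ 2 = wInt (l - 1 / 2) hα (P s * P s) :=
    Real.sq_sqrt (wInt_mul_self_pos (ne_zero (hP s))).le
  have hr0 : 0 < √l := Real.sqrt_pos.2 (by linarith)
  have h2 := wInt_one_le hα hl hr0 (Real.sq_sqrt (by linarith))
  have hy1 := eval_one_pos hα (hP s)
  have hW : 0 < (1 - ρ ^ 2) ^ (l / 2) := Real.rpow_pos_of_pos hρ2 _
  rw [Real.div_rpow zero_le_one hρ2.le, Real.one_rpow]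
  generalize wInt (l - 1 / 2) hα (P s * P s) = V at *
  generalize √V = S at *
  rw [← hS] at h1
  generalize (1 - ρ ^ 2) ^ (l / 2) = W at *
  generalize √l = r at *
  have hN : 0 < (s : ℝ) + l := by positivity
  have h3 : (s + l) * S ^ 2 * (1 / a 0) ≤
      2000 * s * (s + l) * r * S / W * (3 / r) * (P s).eval 1 := by
    calc _ = (s + (l - 1 / 2) + 1 / 2) * S ^ 2 * (1 / a 0) := by ring
      _ ≤ _ := h1
      _ ≤ _ := by gcongr
  refine le_of_mul_le_mul_left (h3.trans_eq ?_) (by positivity : 0 < (s + l) * S ^ 2)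
  field_simp
  ring

end Main

end JacobiLP

/-- Proposition 1.2: for `n ≥ 6`, `N_LP(n,k) ≤ O(k) (1/(1-ρ²))^{(n-2)/4} P_ℓ(1)/‖P_ℓ‖₂`,
where `ℓ = k` for even `k`, `ℓ = k+1` for odd `k`, and `ρ` is the maximal root of
the Jacobi polynomial `P_ℓ^{((n-5)/2,(n-5)/2)}` (here the family `Q`). -/
theorem lp_design_upper_bound :
    ∃ C : ℝ, 0 < C ∧
      ∀ n : ℕ, 6 ≤ n →
      ∀ k : ℕ, 1 ≤ k →
      ∀ P Q : ℕ → Polynomial ℝ,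
        (∀ s, IsJacobi (((n : ℝ) - 3) / 2) s (P s)) →
        (∀ s, IsJacobi (((n : ℝ) - 5) / 2) s (Q s)) →
      ∀ ℓ : ℕ, ℓ = (if Even k then k else k + 1) →
      ∀ ρ : ℝ, IsGreatest {t : ℝ | (Q ℓ).eval t = 0} ρ →
      NLP k P ≤ C * k * (1 / (1 - ρ ^ 2)) ^ (((n : ℝ) - 2) / 4) *
        ((P ℓ).eval 1 / jNorm n (P ℓ)) := by
  refine ⟨12000, by norm_num, ?_⟩
  intro n hn k hk P Q hP hQ ℓ hℓ ρ hρ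
  have hn' : (6 : ℝ) ≤ n := by exact_mod_cast hn
  obtain ⟨l, hl⟩ : ∃ l : ℝ, l = ((n : ℝ) - 2) / 2 := ⟨_, rfl⟩
  have hl2 : 2 ≤ l := by linarith
  have hα : 0 ≤ l - 1 / 2 := by linarith
  have e1 : ((n : ℝ) - 3) / 2 = l - 1 / 2 := by rw [hl]; ring
  have e2 : ((n : ℝ) - 5) / 2 = l - 3 / 2 := by rw [hl]; ring
  have e3 : ((n : ℝ) - 2) / 4 = l / 2 := by rw [hl]; ring
  rw [e1] at hP
  rw [e2] at hQ
  have hev : Even ℓ := by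
    rw [hℓ]
    split_ifs with h
    · exact h
    · exact (Nat.not_even_iff_odd.1 h).add_one
  have hkl : k ≤ ℓ ∧ ℓ ≤ 2 * k := by
    rw [hℓ]
    split_ifs <;> omega
  have hs : 2 ≤ ℓ := by
    obtain ⟨c, hc⟩ := hev
    omega
  have hnorm : jNorm n (P ℓ) = √(JacobiLP.wInt (l - 1 / 2) hα (P ℓ * P ℓ)) := by
    rw [jNorm, JacobiLP.wInt_apply]
    simp only [jWeight, e1, eval_mul, pow_two]
  have hρ2 : 0 < 1 - ρ ^ 2 := by
    have hb : 0 < l - 3 / 2 := by linarith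
    have h0 := JacobiLP.pos_of_isGreatest_root hb hev (hQ ℓ) hρ
    have h1 := JacobiLP.largestRoot_lt_one hb (JacobiLP.jacobiODE hb.le (hQ ℓ))
      (JacobiLP.eval_one_pos hb.le (hQ ℓ)) hρ
    nlinarith
  have hy1 := JacobiLP.eval_one_pos hα (hP ℓ)
  rw [hnorm, e3]
  refine Real.sSup_le ?_ (by positivity)
  rintro _ ⟨m, a, F, hF, hF0, hF1, ha0, ha, rfl⟩
  refine (JacobiLP.one_div_coeff_zero_le hl2 hα hs hev hP (hQ ℓ) hρ hF hF0 hF1 ha0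
    fun j hj => ha j (hkl.1.trans hj)).trans ?_
  have hk2 : 6000 * (ℓ : ℝ) ≤ 12000 * k := by
    have : (ℓ : ℝ) ≤ 2 * k := by exact_mod_cast hkl.2
    linarith
  gcongr
end
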